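/- Let N ≥ 1, 0 ≤ δ < ρ ≤ 1, and fix a compact set K₀ ⊆ ℝ^N. Then there exist k ∈ ℕ and C > 0 (depending only on N, ρ, δ and K₀) such that for every symbol σ of class S^0_{ρ,δ}(ℝ^N × ℝ^N) with σ(x,ξ) = 0 for x ∉ K₀, the operator A_σ satisfies, for all Schwartz f, ‖A_σ f‖_{L²} ≤ C · (max_{|α| ≤ k, |β| ≤ k} sup_{x,ξ} |∂^α_ξ ∂^β_x σ(x,ξ)| · ⟨ξ⟩^{ρ|α| − δ|β|}) · ‖f‖_{L²}. In particular the map σ ↦ A_σ, from symbols of order 0 supported over K₀ (with the seminorm topology) to bounded operators on L²(ℝ^N), is continuous. (The continuity assertion 'the map A → A′ is continuous' of Proposition 5.2 of the paper.) -/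

import Mathlib

open MeasureTheory Filter

/-- Partial derivative of a symbol `a(x, θ)` in the `i`-th coordinate of the
spatial variable `x`. -/
noncomputable def pdX {n N : ℕ} (i : Fin n)
    (a : (Fin n → ℝ) → (Fin N → ℝ) → ℂ) : (Fin n → ℝ) → (Fin N → ℝ) → ℂ :=
  fun x θ => fderiv ℝ (fun x' => a x' θ) x (Pi.single i 1)

/-- Partial derivative of a symbol `a(x, θ)` in the `i`-th coordinate of the
frequency variable `θ`. -/
noncomputable def pdTheta {n N : ℕ} (i : Fin N)
    (a : (Fin n → ℝ) → (Fin N → ℝ) → ℂ) : (Fin n → ℝ) → (Fin N → ℝ) → ℂ :=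
  fun x θ => fderiv ℝ (fun θ' => a x θ') θ (Pi.single i 1)

/-- The iterated partial derivative `∂^α_θ ∂^β_x a` of a symbol, where the multi-indices
`α`, `β` are recorded as lists `Lθ`, `Lx` of coordinate directions (the length of the list
is the total order `|α|`, resp. `|β|`, of the multi-index). -/
noncomputable def symbolDeriv {n N : ℕ} (Lx : List (Fin n)) (Lθ : List (Fin N))
    (a : (Fin n → ℝ) → (Fin N → ℝ) → ℂ) : (Fin n → ℝ) → (Fin N → ℝ) → ℂ :=
  Lx.foldr pdX (Lθ.foldr pdTheta a)

/-- The japanese-bracket weight `⟨θ⟩^s = (1 + |θ|²)^(s/2)`. -/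
noncomputable def jweight {N : ℕ} (s : ℝ) (θ : Fin N → ℝ) : ℝ :=
  (1 + ‖θ‖ ^ 2) ^ (s / 2 : ℝ)

/-- The Hörmander class `S^m_{ρ,δ}(W × ℝ^N)`: `a` is smooth on `W × ℝ^N` and every iterated
derivative `∂^α_θ ∂^β_x a` is bounded on `K × ℝ^N` (`K ⊆ W` compact) by a constant times
`⟨θ⟩^(m - ρ|α| + δ|β|)`. -/
def IsHormanderSymbol {n N : ℕ} (ρ δ m : ℝ) (W : Set (Fin n → ℝ))
    (a : (Fin n → ℝ) → (Fin N → ℝ) → ℂ) : Prop :=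
  ContDiffOn ℝ (⊤ : ℕ∞) (fun p : (Fin n → ℝ) × (Fin N → ℝ) => a p.1 p.2) (W ×ˢ Set.univ) ∧
  ∀ K : Set (Fin n → ℝ), K ⊆ W → IsCompact K →
    ∀ (Lx : List (Fin n)) (Lθ : List (Fin N)), ∃ C : ℝ, 0 ≤ C ∧
      ∀ x ∈ K, ∀ θ : Fin N → ℝ,
        ‖symbolDeriv Lx Lθ a x θ‖ ≤
          C * jweight (m - ρ * (Lθ.length : ℝ) + δ * (Lx.length : ℝ)) θ

/-- A continuous family over `T` with values in `S^m_{ρ,δ}(W × ℝ^N)` : each `a t` lies in the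
class, and `t ↦ a t` is continuous for the Fréchet seminorm topology, i.e. for each `t₀`,
compact `K ⊆ W` and multi-indices, the corresponding seminorm of `a t - a t₀` is eventually
smaller than any `ε > 0`. -/
def IsContinuousSymbolFamily {T : Type*} [TopologicalSpace T] {n N : ℕ}
    (ρ δ m : ℝ) (W : Set (Fin n → ℝ))
    (a : T → (Fin n → ℝ) → (Fin N → ℝ) → ℂ) : Prop :=
  (∀ t, IsHormanderSymbol ρ δ m W (a t)) ∧
  ∀ t₀ : T, ∀ K : Set (Fin n → ℝ), K ⊆ W → IsCompact K →
    ∀ (Lx : List (Fin n)) (Lθ : List (Fin N)), ∀ ε : ℝ, 0 < ε →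
      ∀ᶠ t in nhds t₀, ∀ x ∈ K, ∀ θ : Fin N → ℝ,
        ‖symbolDeriv Lx Lθ (fun x' θ' => a t x' θ' - a t₀ x' θ') x θ‖ ≤
          ε * jweight (m - ρ * (Lθ.length : ℝ) + δ * (Lx.length : ℝ)) θ

/-- The dot product `x · ξ = ∑ i, x i * ξ i` on `ℝ^N`. -/
noncomputable def dotProd {N : ℕ} (x ξ : Fin N → ℝ) : ℝ := ∑ i, x i * ξ i

/-- The Fourier transform `𝓕 f (ξ) = ∫ e^{-2πi y·ξ} f(y) dy`. -/
noncomputable def fourierT {N : ℕ} (f : (Fin N → ℝ) → ℂ) (ξ : Fin N → ℝ) : ℂ :=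
  ∫ y : Fin N → ℝ, Complex.exp (-(2 * (Real.pi : ℂ) * Complex.I * (dotProd y ξ : ℂ))) * f y

/-- The pseudodifferential operator with symbol `σ`:
`A_σ f (x) = ∫ e^{2πi x·ξ} σ(x,ξ) 𝓕f(ξ) dξ`. -/
noncomputable def pdoApply {N : ℕ} (σ : (Fin N → ℝ) → (Fin N → ℝ) → ℂ)
    (f : (Fin N → ℝ) → ℂ) (x : Fin N → ℝ) : ℂ :=
  ∫ ξ : Fin N → ℝ,
    Complex.exp (2 * (Real.pi : ℂ) * Complex.I * (dotProd x ξ : ℂ)) * σ x ξ * fourierT f ξ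

section PdoHelpers

open scoped FourierTransform SchwartzMap

section Plancherel

variable {V : Type*} [NormedAddCommGroup V] [InnerProductSpace ℝ V] [FiniteDimensional ℝ V]
  [MeasurableSpace V] [BorelSpace V]

/-- The Fourier transform of an integrable function is continuous. -/
lemma continuous_fourier_of_integrable {g : V → ℂ} (hg : Integrable g) : Continuous (𝓕 g) :=
  VectorFourier.fourierIntegral_continuous Real.continuous_fourierChar
    (by exact continuous_inner) hg

/-- On `L¹ ∩ L²` the `L²` Fourier transform agrees with the Fourier integral. -/
lemma coeFn_fourier_toLp {g : V → ℂ} (hg : Integrable g) (hg2 : MemLp g 2) :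
    (𝓕 (hg2.toLp g) : Lp (α := V) ℂ 2) =ᵐ[volume] 𝓕 g := by
  refine ae_eq_of_integral_contDiff_smul_eq ?_ ?_ fun φ hφ hφc => ?_
  · exact (Lp.memLp _).locallyIntegrable (by norm_num)
  · exact (continuous_fourier_of_integrable hg).locallyIntegrable
  · have hc : HasCompactSupport (fun x => (φ x : ℂ)) := hφc.comp_left Complex.ofReal_zero
    have hs : ContDiff ℝ (⊤ : ℕ∞) (fun x => (φ x : ℂ)) := Complex.ofRealCLM.contDiff.comp hφ
    let Φ : 𝓢(V, ℂ) := hc.toSchwartzMap hs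
    have hΦ : ∀ x, Φ x = (φ x : ℂ) := fun x => rfl
    have h1 := congrArg (fun T => T Φ) (Lp.fourier_toTemperedDistribution_eq (hg2.toLp g))
    simp only [TemperedDistribution.fourier_apply, Lp.toTemperedDistribution_apply] at h1
    have h2 : ∫ x, (𝓕 Φ) x • (hg2.toLp g) x = ∫ x, (𝓕 Φ) x • g x := by
      apply integral_congr_ae
      filter_upwards [hg2.coeFn_toLp] with x hx
      rw [hx]
    have h3 : ∫ x, (𝓕 (Φ : V → ℂ)) x • g x = ∫ x, Φ x • (𝓕 g) x := by
      simpa using! (VectorFourier.integral_fourierIntegral_smul_eq_flip (L := innerₗ V)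
        Real.continuous_fourierChar continuous_inner Φ.integrable hg)
    rw [h2, SchwartzMap.fourier_coe, h3] at h1
    simpa [hΦ] using h1.symm

/-- Plancherel's theorem on `L¹ ∩ L²`. -/
lemma eLpNorm_fourier_eq {g : V → ℂ} (hg : Integrable g) (hg2 : MemLp g 2) :
    eLpNorm (𝓕 g) 2 volume = eLpNorm g 2 volume := by
  rw [← eLpNorm_congr_ae (coeFn_fourier_toLp hg hg2), ← eLpNorm_congr_ae hg2.coeFn_toLp,
    ← Lp.enorm_def, ← Lp.enorm_def, ← ofReal_norm, ← ofReal_norm, Lp.norm_fourier_eq]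

end Plancherel

section Coordinates

variable {N : ℕ}

lemma dotProd_eq_inner (x y : EuclideanSpace ℝ (Fin N)) : dotProd (x.ofLp) y.ofLp = inner ℝ x y := by
  simp [dotProd, PiLp.inner_apply, mul_comm]

lemma dotProd_neg_left (x ξ : Fin N → ℝ) : dotProd (-x) ξ = -dotProd x ξ := by
  simp [dotProd]

lemma dotProd_sub_right (x ξ η : Fin N → ℝ) : dotProd x (ξ - η) = dotProd x ξ - dotProd x η := by
  simp [dotProd, mul_sub]

lemma dotProd_comm (x ξ : Fin N → ℝ) : dotProd x ξ = dotProd ξ x := by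
  simp [dotProd, mul_comm]

@[fun_prop]
lemma continuous_dotProd {X : Type*} [TopologicalSpace X] {u v : X → Fin N → ℝ}
    (hu : Continuous u) (hv : Continuous v) : Continuous fun x => dotProd (u x) (v x) := by
  unfold dotProd
  fun_prop

lemma norm_exp_two_pi_mul_I (t : ℝ) :
    ‖Complex.exp (2 * (Real.pi : ℂ) * Complex.I * (t : ℂ))‖ = 1 := by
  rw [show 2 * (Real.pi : ℂ) * Complex.I * (t : ℂ) = ((2 * Real.pi * t : ℝ) : ℂ) * Complex.I by
    push_cast; ring]
  exact Complex.norm_exp_ofReal_mul_I _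

lemma norm_exp_neg_two_pi_mul_I (t : ℝ) :
    ‖Complex.exp (-(2 * (Real.pi : ℂ) * Complex.I * (t : ℂ)))‖ = 1 := by
  rw [show -(2 * (Real.pi : ℂ) * Complex.I * (t : ℂ)) =
    2 * (Real.pi : ℂ) * Complex.I * ((-t : ℝ) : ℂ) by push_cast; ring]
  exact norm_exp_two_pi_mul_I _

lemma fourierT_ofLp (g : (Fin N → ℝ) → ℂ) (ξ : EuclideanSpace ℝ (Fin N)) :
    fourierT g ξ.ofLp = 𝓕 (fun x : EuclideanSpace ℝ (Fin N) => g x.ofLp) ξ := by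
  rw [fourierT, Real.fourier_eq', ← (PiLp.volume_preserving_ofLp (Fin N)).integral_comp
    (MeasurableEquiv.toLp 2 (Fin N → ℝ)).symm.measurableEmbedding]
  refine integral_congr_ae (.of_forall fun x => ?_)
  simp only [dotProd_eq_inner, smul_eq_mul]
  congr 2
  push_cast
  ring

lemma integrable_comp_ofLp {g : (Fin N → ℝ) → ℂ} (hg : Integrable g) :
    Integrable fun x : EuclideanSpace ℝ (Fin N) => g x.ofLp :=
  ((PiLp.volume_preserving_ofLp (Fin N)).integrable_comp_emb
    (MeasurableEquiv.toLp 2 (Fin N → ℝ)).symm.measurableEmbedding).2 hg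

lemma continuous_fourierT {g : (Fin N → ℝ) → ℂ} (hg : Integrable g) : Continuous (fourierT g) := by
  have := (continuous_fourier_of_integrable (integrable_comp_ofLp hg)).comp
    (PiLp.continuous_toLp 2 (fun _ : Fin N => ℝ))
  refine this.congr fun ξ => ?_
  simp [← fourierT_ofLp]

lemma norm_fourierT_le (g : (Fin N → ℝ) → ℂ) (ξ : Fin N → ℝ) :
    ‖fourierT g ξ‖ ≤ ∫ x, ‖g x‖ := by
  refine (norm_integral_le_integral_norm _).trans_eq ?_
  simp_rw [norm_mul, norm_exp_neg_two_pi_mul_I, one_mul]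

/-- Plancherel's theorem for `fourierT`. -/
lemma eLpNorm_fourierT_eq {g : (Fin N → ℝ) → ℂ} (hg : Integrable g) (hg2 : MemLp g 2) :
    eLpNorm (fourierT g) 2 volume = eLpNorm g 2 volume := by
  have mp := PiLp.volume_preserving_ofLp (Fin N)
  rw [← eLpNorm_comp_measurePreserving hg2.aestronglyMeasurable mp,
    ← eLpNorm_comp_measurePreserving (continuous_fourierT hg).aestronglyMeasurable mp]
  have : fourierT g ∘ WithLp.ofLp = 𝓕 (fun x : EuclideanSpace ℝ (Fin N) => g x.ofLp) := by
    ext ξ; exact fourierT_ofLp g ξ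
  rw [this]
  exact eLpNorm_fourier_eq (integrable_comp_ofLp hg) (hg2.comp_measurePreserving mp)

/-- Fourier inversion for `fourierT`. -/
lemma fourierT_inversion {φ : (Fin N → ℝ) → ℂ} (hc : Continuous φ) (hφ : Integrable φ)
    (hφ' : Integrable (fourierT φ)) (ξ : Fin N → ℝ) :
    φ ξ = ∫ y, Complex.exp (2 * (Real.pi : ℂ) * Complex.I * (dotProd y ξ : ℂ)) * fourierT φ y := by
  have h1 : (𝓕 (fun x : EuclideanSpace ℝ (Fin N) => φ x.ofLp)) = fun x => fourierT φ x.ofLp := by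
    ext x; rw [fourierT_ofLp]
  have h := Continuous.fourierInv_fourier_eq (f := fun x : EuclideanSpace ℝ (Fin N) => φ x.ofLp)
    (by fun_prop) (integrable_comp_ofLp hφ) (by rw [h1]; exact integrable_comp_ofLp hφ')
  have h2 := congrFun h (WithLp.toLp 2 ξ)
  simp only at h2
  rw [← h2, Real.fourierInv_eq', h1, ← (PiLp.volume_preserving_ofLp (Fin N)).integral_comp
    (MeasurableEquiv.toLp 2 (Fin N → ℝ)).symm.measurableEmbedding]
  refine integral_congr_ae (.of_forall fun x => ?_)
  have : dotProd x.ofLp ξ = inner ℝ x (WithLp.toLp 2 ξ) := dotProd_eq_inner x (WithLp.toLp 2 ξ)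
  simp only [this, smul_eq_mul]
  congr 2
  push_cast
  ring

/-- The Fourier transform of a Schwartz function is integrable. -/
lemma integrable_fourierT_schwartz (f : 𝓢(Fin N → ℝ, ℂ)) : Integrable (fourierT f) := by
  let F : 𝓢(EuclideanSpace ℝ (Fin N), ℂ) :=
    SchwartzMap.compCLMOfContinuousLinearEquiv ℝ (EuclideanSpace.equiv (Fin N) ℝ) f
  have h : Integrable (fun x : EuclideanSpace ℝ (Fin N) => fourierT f x.ofLp) := by
    refine (𝓕 F).integrable.congr (.of_forall fun x => ?_)
    simp only [fourierT_ofLp, SchwartzMap.fourier_coe]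
    rfl
  exact ((PiLp.volume_preserving_ofLp (Fin N)).integrable_comp_emb
    (MeasurableEquiv.toLp 2 (Fin N → ℝ)).symm.measurableEmbedding).1 h

/-- A Schwartz function has an integrable, square-integrable Fourier transform, of the same
`L²` norm. -/
lemma memLp_fourierT_schwartz (f : 𝓢(Fin N → ℝ, ℂ)) : MemLp (fourierT f) 2 := by
  refine ⟨(continuous_fourierT f.integrable).aestronglyMeasurable, ?_⟩
  have h2 : MemLp f 2 volume := f.memLp 2 volume
  rw [eLpNorm_fourierT_eq f.integrable h2]
  exact h2.eLpNorm_lt_top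

end Coordinates

section CoordDeriv

variable {N : ℕ}

/-- The partial derivative of a function on `ℝ^N` in the `j`-th coordinate. -/
noncomputable def coordDeriv (j : Fin N) (g : (Fin N → ℝ) → ℂ) : (Fin N → ℝ) → ℂ :=
  fun x => fderiv ℝ g x (Pi.single j 1)

lemma symbolDeriv_replicate_nil (j : Fin N) (k : ℕ) (σ : (Fin N → ℝ) → (Fin N → ℝ) → ℂ)
    (x ξ : Fin N → ℝ) :
    symbolDeriv (List.replicate k j) [] σ x ξ = (coordDeriv j)^[k] (fun x' => σ x' ξ) x := by
  induction k generalizing x with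
  | zero => rfl
  | succ k ih =>
    rw [Function.iterate_succ_apply', ← funext ih]
    rfl

lemma symbolDeriv_nil_replicate (j : Fin N) (k : ℕ) (σ : (Fin N → ℝ) → (Fin N → ℝ) → ℂ)
    (x ξ : Fin N → ℝ) :
    symbolDeriv [] (List.replicate k j) σ x ξ = (coordDeriv j)^[k] (fun ξ' => σ x ξ') ξ := by
  induction k generalizing ξ with
  | zero => rfl
  | succ k ih =>
    rw [Function.iterate_succ_apply', ← funext ih]
    rfl

lemma ContDiff.coordDeriv {g : (Fin N → ℝ) → ℂ} (hg : ContDiff ℝ (⊤ : ℕ∞) g) (j : Fin N) :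
    ContDiff ℝ (⊤ : ℕ∞) (coordDeriv j g) :=
  (hg.fderiv_right (by norm_cast)).clm_apply contDiff_const

lemma ContDiff.iterate_coordDeriv {g : (Fin N → ℝ) → ℂ} (hg : ContDiff ℝ (⊤ : ℕ∞) g) (j : Fin N)
    (k : ℕ) : ContDiff ℝ (⊤ : ℕ∞) ((_root_.coordDeriv j)^[k] g) := by
  induction k with
  | zero => exact hg
  | succ k ih =>
    rw [Function.iterate_succ_apply']
    exact ih.coordDeriv j

lemma tsupport_iterate_coordDeriv_subset (g : (Fin N → ℝ) → ℂ) (j : Fin N) (k : ℕ) :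
    tsupport ((coordDeriv j)^[k] g) ⊆ tsupport g := by
  induction k with
  | zero => exact subset_rfl
  | succ k ih =>
    rw [Function.iterate_succ_apply']
    exact (tsupport_fderiv_apply_subset ℝ _).trans ih

lemma HasCompactSupport.iterate_coordDeriv {g : (Fin N → ℝ) → ℂ} (hg : HasCompactSupport g)
    (j : Fin N) (k : ℕ) : HasCompactSupport ((_root_.coordDeriv j)^[k] g) :=
  hg.mono' ((subset_tsupport _).trans (tsupport_iterate_coordDeriv_subset g j k))

lemma coordDeriv_add {u v : (Fin N → ℝ) → ℂ} (hu : ContDiff ℝ (⊤ : ℕ∞) u)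
    (hv : ContDiff ℝ (⊤ : ℕ∞) v) (j : Fin N) :
    coordDeriv j (fun x => u x + v x) = fun x => coordDeriv j u x + coordDeriv j v x := by
  ext x
  simp only [coordDeriv]
  rw [fderiv_fun_add (hu.differentiable (by simp) x) (hv.differentiable (by simp) x)]
  rfl

lemma iterate_coordDeriv_add {u v : (Fin N → ℝ) → ℂ} (hu : ContDiff ℝ (⊤ : ℕ∞) u)
    (hv : ContDiff ℝ (⊤ : ℕ∞) v) (j : Fin N) (k : ℕ) :
    (coordDeriv j)^[k] (fun x => u x + v x) =
      fun x => (coordDeriv j)^[k] u x + (coordDeriv j)^[k] v x := by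
  induction k with
  | zero => rfl
  | succ k ih =>
    simp only [Function.iterate_succ_apply', ih]
    exact coordDeriv_add (hu.iterate_coordDeriv j k) (hv.iterate_coordDeriv j k) j

lemma coordDeriv_mul {u v : (Fin N → ℝ) → ℂ} (hu : ContDiff ℝ (⊤ : ℕ∞) u)
    (hv : ContDiff ℝ (⊤ : ℕ∞) v) (j : Fin N) :
    coordDeriv j (fun x => u x * v x) =
      fun x => coordDeriv j u x * v x + u x * coordDeriv j v x := by
  ext x
  simp only [coordDeriv]
  rw [fderiv_fun_mul (hu.differentiable (by simp) x) (hv.differentiable (by simp) x)]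
  simp only [add_apply, smul_apply, smul_eq_mul]
  ring

/-- A pointwise Leibniz bound for iterated partial derivatives of a product. -/
lemma norm_iterate_coordDeriv_mul_le (j : Fin N) (x : Fin N → ℝ) {r : ℝ} (k : ℕ)
    {u v : (Fin N → ℝ) → ℂ} (hu : ContDiff ℝ (⊤ : ℕ∞) u) (hv : ContDiff ℝ (⊤ : ℕ∞) v) {U V : ℝ}
    (hU : ∀ i ≤ k, ‖(coordDeriv j)^[i] u x‖ ≤ U * r ^ i)
    (hV : ∀ i ≤ k, ‖(coordDeriv j)^[i] v x‖ ≤ V * r ^ i) :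
    ‖(coordDeriv j)^[k] (fun x => u x * v x) x‖ ≤ U * V * (2 * r) ^ k := by
  induction k generalizing u v U V with
  | zero =>
    have h1 := hU 0 le_rfl
    have h2 := hV 0 le_rfl
    simp only [Function.iterate_zero, id, pow_zero, mul_one, norm_mul] at *
    exact mul_le_mul h1 h2 (norm_nonneg _) ((norm_nonneg _).trans h1)
  | succ k ih =>
    rw [Function.iterate_succ_apply, coordDeriv_mul hu hv,
      iterate_coordDeriv_add ((hu.coordDeriv j).mul hv) (hu.mul (hv.coordDeriv j))]
    have h1 := ih (hu.coordDeriv j) hv (U := U * r) (V := V)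
      (fun i hi => by
        have := hU (i + 1) (by omega)
        rwa [Function.iterate_succ_apply, pow_succ', ← mul_assoc] at this)
      (fun i hi => hV i (by omega))
    have h2 := ih hu (hv.coordDeriv j) (U := U) (V := V * r)
      (fun i hi => hU i (by omega))
      (fun i hi => by
        have := hV (i + 1) (by omega)
        rwa [Function.iterate_succ_apply, pow_succ', ← mul_assoc] at this)
    refine (norm_add_le _ _).trans ((add_le_add h1 h2).trans_eq ?_)
    ring

/-- Iterated partial derivatives of a dilated translate. -/
lemma iterate_coordDeriv_comp_smul_sub {χ : (Fin N → ℝ) → ℂ} (hχ : ContDiff ℝ (⊤ : ℕ∞) χ)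
    (c : ℝ) (a : Fin N → ℝ) (j : Fin N) (k : ℕ) :
    (coordDeriv j)^[k] (fun ξ => χ (c • (ξ - a))) =
      fun ξ => (c : ℂ) ^ k * (coordDeriv j)^[k] χ (c • (ξ - a)) := by
  induction k with
  | zero => simp
  | succ k ih =>
    simp only [Function.iterate_succ_apply', ih]
    ext ξ
    set w := (coordDeriv j)^[k] χ with hw
    have hwd : Differentiable ℝ w := (hχ.iterate_coordDeriv j k).differentiable (by simp)
    have hin : HasFDerivAt (fun ξ : Fin N → ℝ => c • (ξ - a))
        (c • ContinuousLinearMap.id ℝ (Fin N → ℝ)) ξ := ((hasFDerivAt_id ξ).sub_const a).const_smul c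
    have h : HasFDerivAt (fun ξ : Fin N → ℝ => (c : ℂ) ^ k * w (c • (ξ - a))) _ ξ :=
      ((hwd (c • (ξ - a))).hasFDerivAt.comp ξ hin).const_mul ((c : ℂ) ^ k)
    rw [coordDeriv, h.fderiv, coordDeriv]
    simp [pow_succ, mul_assoc]

end CoordDeriv

section Decay

variable {N : ℕ}

lemma fourierT_coordDeriv {g : (Fin N → ℝ) → ℂ} (hg : ContDiff ℝ (⊤ : ℕ∞) g)
    (hc : HasCompactSupport g) (j : Fin N) (t : Fin N → ℝ) :
    fourierT (coordDeriv j g) t = 2 * Real.pi * Complex.I * t j * fourierT g t := by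
  let e : (Fin N → ℝ) → ℂ := fun y =>
    Complex.exp (-(2 * (Real.pi : ℂ) * Complex.I * (dotProd y t : ℂ)))
  have hlin : ∀ y, dotProd y t = (∑ i, t i • ContinuousLinearMap.proj (R := ℝ) (φ := fun _ => ℝ) i :
      (Fin N → ℝ) →L[ℝ] ℝ) y := by
    intro y; simp [dotProd, mul_comm]
  set L : (Fin N → ℝ) →L[ℝ] ℝ :=
    ∑ i, t i • ContinuousLinearMap.proj (R := ℝ) (φ := fun _ => ℝ) i with hL
  have hLj : L (Pi.single j 1) = t j := by
    rw [← hlin]; simp [dotProd, Pi.single_apply]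
  have he : ∀ y, HasFDerivAt e
      (e y • (-(2 * (Real.pi : ℂ) * Complex.I)) • (Complex.ofRealCLM.comp L)) y := by
    intro y
    have h0 : HasFDerivAt (fun y => -(2 * (Real.pi : ℂ) * Complex.I) * (Complex.ofRealCLM.comp L) y)
        ((-(2 * (Real.pi : ℂ) * Complex.I)) • (Complex.ofRealCLM.comp L)) y :=
      (Complex.ofRealCLM.comp L).hasFDerivAt.const_mul _
    have heq : ∀ y, e y =
        Complex.exp (-(2 * (Real.pi : ℂ) * Complex.I) * (Complex.ofRealCLM.comp L) y) := by
      intro y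
      simp only [e, hlin, neg_mul, ContinuousLinearMap.comp_apply, Complex.ofRealCLM_apply]
    rw [heq y]
    exact h0.cexp.congr_of_eventuallyEq (.of_forall heq)
  have hed : Differentiable ℝ e := fun y => (he y).differentiableAt
  have hder : ∀ y, fderiv ℝ e y (Pi.single j 1) = -(2 * Real.pi * Complex.I * t j) * e y := by
    intro y
    rw [(he y).fderiv]
    simp [hLj]
    ring
  have hgc := hg.continuous
  have hDc := (hg.coordDeriv j).continuous
  have hcD : HasCompactSupport (coordDeriv j g) := by
    simpa using hc.iterate_coordDeriv j 1
  have key := integral_mul_fderiv_eq_neg_fderiv_mul_of_integrable (μ := volume) (f := e) (g := g)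
    (v := Pi.single j 1) ?_ ?_ ?_ (fun x _ => hed x)
    (fun x _ => hg.differentiable (by simp) x)
  · simp only [fourierT]
    change ∫ y, e y * fderiv ℝ g y (Pi.single j 1) = _ * ∫ y, e y * g y
    rw [key, ← integral_neg, ← integral_const_mul]
    refine integral_congr_ae (.of_forall fun y => ?_)
    simp only [hder]
    ring
  · simp only [hder, mul_assoc]
    exact ((hed.continuous.mul hgc).integrable_of_hasCompactSupport hc.mul_left).const_mul _
  · exact (hed.continuous.mul hDc).integrable_of_hasCompactSupport hcD.mul_left
  · exact (hed.continuous.mul hgc).integrable_of_hasCompactSupport hc.mul_left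

lemma fourierT_iterate_coordDeriv {g : (Fin N → ℝ) → ℂ} (hg : ContDiff ℝ (⊤ : ℕ∞) g)
    (hc : HasCompactSupport g) (j : Fin N) (k : ℕ) (t : Fin N → ℝ) :
    fourierT ((coordDeriv j)^[k] g) t = (2 * Real.pi * Complex.I * t j) ^ k * fourierT g t := by
  induction k with
  | zero => simp
  | succ k ih =>
    rw [Function.iterate_succ_apply', fourierT_coordDeriv (hg.iterate_coordDeriv j k)
      (hc.iterate_coordDeriv j k), ih]
    ring

/-- Decay of the Fourier transform in terms of pure partial derivatives. -/
lemma norm_pow_mul_fourierT_le [NeZero N] {g : (Fin N → ℝ) → ℂ} (hg : ContDiff ℝ (⊤ : ℕ∞) g)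
    (hc : HasCompactSupport g) (k : ℕ) {M : ℝ}
    (hM : ∀ j, ∫ x, ‖(coordDeriv j)^[k] g x‖ ≤ M) (t : Fin N → ℝ) :
    ‖t‖ ^ k * ‖fourierT g t‖ ≤ M := by
  obtain ⟨j, hj⟩ : ∃ j, ‖t‖ = |t j| := by
    obtain ⟨j, hj⟩ := Finite.exists_max fun j => ‖t j‖
    exact ⟨j, le_antisymm ((pi_norm_le_iff_of_nonneg (norm_nonneg _)).2 hj) (norm_le_pi_norm t j)⟩
  refine le_trans ?_ ((norm_fourierT_le _ t).trans (hM j))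
  rw [fourierT_iterate_coordDeriv hg hc, norm_mul, norm_pow]
  gcongr
  rw [hj]
  simp only [norm_mul, Complex.norm_ofNat, Complex.norm_real, Complex.norm_I, mul_one,
    Real.norm_eq_abs, abs_of_pos Real.pi_pos]
  nlinarith [abs_nonneg (t j), Real.pi_gt_three]

end Decay

section Young

variable {E : Type*} [NormedAddCommGroup E] [MeasurableSpace E] [BorelSpace E]
  [SecondCountableTopology E] {μ : Measure E} [SFinite μ] [μ.IsAddLeftInvariant] [μ.IsNegInvariant]

/-- Young's inequality `L¹ * L² ⊆ L²` for nonnegative functions. -/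
lemma lintegral_sq_convolution_le {κ u : E → ENNReal} (hκ : Measurable κ) (hu : AEMeasurable u μ) :
    ∫⁻ x, (∫⁻ y, κ (x - y) * u y ∂μ) ^ 2 ∂μ ≤ (∫⁻ x, κ x ∂μ) ^ 2 * ∫⁻ y, u y ^ 2 ∂μ := by
  have hκx : ∀ x, Measurable fun y => κ (x - y) := fun x => hκ.comp (by fun_prop)
  have hcs : ∀ x, (∫⁻ y, κ (x - y) * u y ∂μ) ^ 2 ≤
      (∫⁻ y, κ y ∂μ) * ∫⁻ y, κ (x - y) * u y ^ 2 ∂μ := by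
    intro x
    have h := ENNReal.lintegral_mul_le_Lp_mul_Lq μ Real.HolderConjugate.two_two
      (f := fun y => κ (x - y) ^ (1 / 2 : ℝ)) (g := fun y => κ (x - y) ^ (1 / 2 : ℝ) * u y)
      ((hκx x).pow_const _).aemeasurable (((hκx x).pow_const _).aemeasurable.mul hu)
    have hhalf : ∀ a : ENNReal, a ^ (1 / 2 : ℝ) * a ^ (1 / 2 : ℝ) = a := fun a => by
      rw [← ENNReal.rpow_add_of_nonneg _ _ (by norm_num) (by norm_num)]; norm_num
    have hsq : ∀ a : ENNReal, (a ^ (1 / 2 : ℝ)) ^ (2 : ℝ) = a := fun a => by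
      rw [← ENNReal.rpow_mul]; norm_num
    simp only [Pi.mul_apply, ← mul_assoc, hhalf, ENNReal.mul_rpow_of_nonneg _ _ zero_le_two,
      hsq] at h
    calc (∫⁻ y, κ (x - y) * u y ∂μ) ^ 2
        ≤ ((∫⁻ y, κ (x - y) ∂μ) ^ (1 / 2 : ℝ) *
            (∫⁻ y, κ (x - y) * u y ^ (2 : ℝ) ∂μ) ^ (1 / 2 : ℝ)) ^ 2 := by gcongr
      _ = (∫⁻ y, κ y ∂μ) * ∫⁻ y, κ (x - y) * u y ^ 2 ∂μ := by
        rw [mul_pow, ← ENNReal.rpow_two, ← ENNReal.rpow_two, hsq, hsq,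
          lintegral_sub_left_eq_self κ x]
        simp
  calc _ ≤ ∫⁻ x, (∫⁻ y, κ y ∂μ) * ∫⁻ y, κ (x - y) * u y ^ 2 ∂μ ∂μ := lintegral_mono hcs
    _ = (∫⁻ y, κ y ∂μ) * ∫⁻ y, ∫⁻ x, κ (x - y) * u y ^ 2 ∂μ ∂μ := by
      have hm : AEMeasurable (Function.uncurry fun x y => κ (x - y) * u y ^ 2) (μ.prod μ) :=
        (hκ.comp (by fun_prop : Measurable fun p : E × E => p.1 - p.2)).aemeasurable.mul
          ((hu.comp_snd).pow_const 2)
      have hm' : AEMeasurable (fun x => ∫⁻ y, κ (x - y) * u y ^ 2 ∂μ) μ := hm.lintegral_prod_right'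
      rw [lintegral_const_mul'' _ hm', lintegral_lintegral_swap hm]
    _ = (∫⁻ y, κ y ∂μ) * ∫⁻ y, (∫⁻ x, κ x ∂μ) * u y ^ 2 ∂μ := by
      congr 2 with y
      have hy : Measurable fun x => κ (x - y) := hκ.comp (by fun_prop)
      rw [lintegral_mul_const _ hy, lintegral_sub_right_eq_self κ y]
    _ = _ := by
      rw [lintegral_const_mul'' _ (hu.pow_const 2)]
      ring

end Young

section SymbolOp

variable {N : ℕ}

/-- The operator with symbol `σ` acting on the frequency side:
`g ↦ ∫ e^{2πi x·ξ} σ(x,ξ) g(ξ) dξ`. -/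
noncomputable def symbolOp (σ : (Fin N → ℝ) → (Fin N → ℝ) → ℂ) (g : (Fin N → ℝ) → ℂ)
    (x : Fin N → ℝ) : ℂ :=
  ∫ ξ : Fin N → ℝ,
    Complex.exp (2 * (Real.pi : ℂ) * Complex.I * (dotProd x ξ : ℂ)) * σ x ξ * g ξ

/-- The kernel of the operator with symbol `σ` between frequency spaces. -/
noncomputable def symbolKernel (σ : (Fin N → ℝ) → (Fin N → ℝ) → ℂ) (ζ ξ : Fin N → ℝ) : ℂ :=
  fourierT (fun x => σ x ξ) (ζ - ξ)

lemma lintegral_enorm_sq_eq (f : (Fin N → ℝ) → ℂ) :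
    ∫⁻ x, ‖f x‖ₑ ^ 2 = eLpNorm f 2 volume ^ 2 := by
  have h := eLpNorm_nnreal_pow_eq_lintegral (f := f) (μ := (volume : Measure (Fin N → ℝ)))
    (p := 2) (by norm_num)
  simpa using h.symm

variable {σ : (Fin N → ℝ) → (Fin N → ℝ) → ℂ} {K₀ : Set (Fin N → ℝ)} {B : ℝ}
  {g : (Fin N → ℝ) → ℂ}

lemma integrable_prod_symbol_mul (hσ : Continuous (Function.uncurry σ)) (hK₀ : IsCompact K₀)
    (hsupp : ∀ x ∉ K₀, ∀ ξ, σ x ξ = 0) (hB : ∀ x ξ, ‖σ x ξ‖ ≤ B) (hg : Integrable g)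
    {u : (Fin N → ℝ) × (Fin N → ℝ) → ℂ} (hu : Continuous u) (hu1 : ∀ p, ‖u p‖ = 1) :
    Integrable (fun p : (Fin N → ℝ) × (Fin N → ℝ) => u p * σ p.1 p.2 * g p.2)
      (volume.prod volume) := by
  have h1 : Integrable (K₀.indicator fun _ => B) (volume : Measure (Fin N → ℝ)) :=
    (integrable_indicator_iff hK₀.measurableSet).2 (integrableOn_const hK₀.measure_lt_top.ne)
  refine (h1.mul_prod hg.norm).mono' ?_ (.of_forall fun p => ?_)
  · exact (hu.mul hσ).aestronglyMeasurable.mul hg.aestronglyMeasurable.comp_snd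
  · simp only [norm_mul, hu1, one_mul]
    by_cases hp : p.1 ∈ K₀
    · rw [Set.indicator_of_mem hp]
      gcongr
      exact hB _ _
    · simp [hsupp _ hp, hp]

lemma integrable_symbolOp (hσ : Continuous (Function.uncurry σ)) (hK₀ : IsCompact K₀)
    (hsupp : ∀ x ∉ K₀, ∀ ξ, σ x ξ = 0) (hB : ∀ x ξ, ‖σ x ξ‖ ≤ B) (hg : Integrable g) :
    Integrable (symbolOp σ g) :=
  (integrable_prod_symbol_mul hσ hK₀ hsupp hB hg
    (u := fun p => Complex.exp (2 * (Real.pi : ℂ) * Complex.I * (dotProd p.1 p.2 : ℂ)))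
    (by fun_prop) (fun p => norm_exp_two_pi_mul_I _)).integral_prod_left

lemma memLp_symbolOp (hσ : Continuous (Function.uncurry σ)) (hK₀ : IsCompact K₀)
    (hsupp : ∀ x ∉ K₀, ∀ ξ, σ x ξ = 0) (hB : ∀ x ξ, ‖σ x ξ‖ ≤ B) (hg : Integrable g) :
    MemLp (symbolOp σ g) 2 := by
  have h : MemLp (K₀.indicator fun _ => B * ∫ ξ, ‖g ξ‖) 2 (volume : Measure (Fin N → ℝ)) :=
    memLp_indicator_const 2 hK₀.measurableSet _ (.inr hK₀.measure_lt_top.ne)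
  refine h.mono (integrable_symbolOp hσ hK₀ hsupp hB hg).aestronglyMeasurable
    (.of_forall fun x => ?_)
  by_cases hx : x ∈ K₀
  · rw [Set.indicator_of_mem hx]
    refine le_trans ?_ (Real.le_norm_self _)
    rw [← integral_const_mul]
    refine norm_integral_le_of_norm_le (hg.norm.const_mul B) (.of_forall fun ξ => ?_)
    rw [norm_mul, norm_mul, norm_exp_two_pi_mul_I, one_mul]
    gcongr
    exact hB _ _
  · simp [symbolOp, hsupp x hx]

lemma integrable_prod_symbolKernel (hσ : Continuous (Function.uncurry σ)) (hK₀ : IsCompact K₀)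
    (hsupp : ∀ x ∉ K₀, ∀ ξ, σ x ξ = 0) (hB : ∀ x ξ, ‖σ x ξ‖ ≤ B) (hg : Integrable g)
    (ζ : Fin N → ℝ) :
    Integrable (fun p : (Fin N → ℝ) × (Fin N → ℝ) =>
      Complex.exp (-(2 * (Real.pi : ℂ) * Complex.I * (dotProd p.1 (ζ - p.2) : ℂ))) * σ p.1 p.2 *
        g p.2) (volume.prod volume) :=
  integrable_prod_symbol_mul hσ hK₀ hsupp hB hg
    (u := fun p => Complex.exp (-(2 * (Real.pi : ℂ) * Complex.I * (dotProd p.1 (ζ - p.2) : ℂ))))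
    (by fun_prop) (fun p => norm_exp_neg_two_pi_mul_I _)

lemma integrable_symbolKernel_mul (hσ : Continuous (Function.uncurry σ)) (hK₀ : IsCompact K₀)
    (hsupp : ∀ x ∉ K₀, ∀ ξ, σ x ξ = 0) (hB : ∀ x ξ, ‖σ x ξ‖ ≤ B) (hg : Integrable g)
    (ζ : Fin N → ℝ) : Integrable fun ξ => symbolKernel σ ζ ξ * g ξ := by
  refine (integrable_prod_symbolKernel hσ hK₀ hsupp hB hg ζ).integral_prod_right.congr
    (.of_forall fun ξ => ?_)
  simp only [symbolKernel, fourierT]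
  rw [← integral_mul_const]

/-- The Fourier transform of `symbolOp σ g` is given by the integral kernel `symbolKernel σ`. -/
lemma fourierT_symbolOp (hσ : Continuous (Function.uncurry σ)) (hK₀ : IsCompact K₀)
    (hsupp : ∀ x ∉ K₀, ∀ ξ, σ x ξ = 0) (hB : ∀ x ξ, ‖σ x ξ‖ ≤ B) (hg : Integrable g)
    (ζ : Fin N → ℝ) : fourierT (symbolOp σ g) ζ = ∫ ξ, symbolKernel σ ζ ξ * g ξ := by
  have hsw := integral_integral_swap (f := fun x ξ =>
    Complex.exp (-(2 * (Real.pi : ℂ) * Complex.I * (dotProd x (ζ - ξ) : ℂ))) * σ x ξ * g ξ)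
    (integrable_prod_symbolKernel hσ hK₀ hsupp hB hg ζ)
  calc fourierT (symbolOp σ g) ζ
      = ∫ x, ∫ ξ, Complex.exp (-(2 * (Real.pi : ℂ) * Complex.I * (dotProd x (ζ - ξ) : ℂ))) *
          σ x ξ * g ξ := by
        refine integral_congr_ae (.of_forall fun x => ?_)
        simp only [symbolOp]
        rw [← integral_const_mul]
        refine integral_congr_ae (.of_forall fun ξ => ?_)
        simp only [dotProd_sub_right]
        rw [← mul_assoc, ← mul_assoc, ← Complex.exp_add]
        congr 3
        push_cast
        ring
    _ = ∫ ξ, symbolKernel σ ζ ξ * g ξ := by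
        rw [hsw]
        refine integral_congr_ae (.of_forall fun ξ => ?_)
        simp only [symbolKernel, fourierT]
        rw [← integral_mul_const]

lemma lintegral_symbolOp_sq_eq (hσ : Continuous (Function.uncurry σ)) (hK₀ : IsCompact K₀)
    (hsupp : ∀ x ∉ K₀, ∀ ξ, σ x ξ = 0) (hB : ∀ x ξ, ‖σ x ξ‖ ≤ B) (hg : Integrable g) :
    ∫⁻ ζ, ‖∫ ξ, symbolKernel σ ζ ξ * g ξ‖ₑ ^ 2 = ∫⁻ x, ‖symbolOp σ g x‖ₑ ^ 2 := by
  simp_rw [← fourierT_symbolOp hσ hK₀ hsupp hB hg]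
  rw [lintegral_enorm_sq_eq, lintegral_enorm_sq_eq,
    eLpNorm_fourierT_eq (integrable_symbolOp hσ hK₀ hsupp hB hg)
      (memLp_symbolOp hσ hK₀ hsupp hB hg)]

lemma measurable_enorm_integral_symbolKernel (hσ : Continuous (Function.uncurry σ))
    (hK₀ : IsCompact K₀) (hsupp : ∀ x ∉ K₀, ∀ ξ, σ x ξ = 0) (hB : ∀ x ξ, ‖σ x ξ‖ ≤ B)
    (hg : Integrable g) : Measurable fun ζ => ‖∫ ξ, symbolKernel σ ζ ξ * g ξ‖ₑ ^ 2 := by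
  simp_rw [← fourierT_symbolOp hσ hK₀ hsupp hB hg]
  exact (continuous_fourierT (integrable_symbolOp hσ hK₀ hsupp hB hg)).enorm.measurable.pow_const 2

/-- If, against `g`, the symbol `σ x` can be replaced by a function whose Fourier transform is
dominated by an even integrable `κ` independent of `x`, then `σ` acts on `g` with norm `‖κ‖₁`. -/
lemma lintegral_symbolOp_sq_le {φ : (Fin N → ℝ) → (Fin N → ℝ) → ℂ} {κ : (Fin N → ℝ) → ℝ}
    (hφc : ∀ x, Continuous (φ x)) (hφi : ∀ x, Integrable (φ x))
    (hκ : Integrable κ) (hκm : Measurable κ) (hκe : ∀ t, κ (-t) = κ t)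
    (hφκ : ∀ x t, ‖fourierT (φ x) t‖ ≤ κ t) (hg : Integrable g) (hg2 : MemLp g 2)
    (hφσ : ∀ x ξ, σ x ξ * g ξ = φ x ξ * g ξ) :
    ∫⁻ x, ‖symbolOp σ g x‖ₑ ^ 2 ≤
      (∫⁻ t, ENNReal.ofReal (κ t)) ^ 2 * ∫⁻ ξ, ‖g ξ‖ₑ ^ 2 := by
  have hFi : ∀ x, Integrable (fourierT (φ x)) := fun x =>
    hκ.mono' (continuous_fourierT (hφi x)).aestronglyMeasurable (.of_forall (hφκ x))
  have hgc := continuous_fourierT hg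
  have hrep : ∀ x, symbolOp σ g x = ∫ w, fourierT (φ x) (w - x) * fourierT g (-w) := by
    intro x
    have hintegral : Integrable (fun p : (Fin N → ℝ) × (Fin N → ℝ) =>
        Complex.exp (2 * (Real.pi : ℂ) * Complex.I * (dotProd (x + p.2) p.1 : ℂ)) *
          (g p.1 * fourierT (φ x) p.2)) (volume.prod volume) := by
      refine (hg.mul_prod (hFi x)).norm.mono' ?_ (.of_forall fun p => ?_)
      · exact Continuous.aestronglyMeasurable (by fun_prop) |>.mul
          (hg.mul_prod (hFi x)).aestronglyMeasurable
      · rw [norm_mul, norm_exp_two_pi_mul_I, one_mul]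
    calc symbolOp σ g x
        = ∫ ξ, ∫ y, Complex.exp (2 * (Real.pi : ℂ) * Complex.I * (dotProd (x + y) ξ : ℂ)) *
          (g ξ * fourierT (φ x) y) := by
          refine integral_congr_ae (.of_forall fun ξ => ?_)
          simp only
          rw [mul_assoc, hφσ, fourierT_inversion (hφc x) (hφi x) (hFi x) ξ, ← integral_mul_const,
            ← integral_const_mul]
          refine integral_congr_ae (.of_forall fun y => ?_)
          have : dotProd (x + y) ξ = dotProd x ξ + dotProd y ξ := by
            simp [dotProd, add_mul, Finset.sum_add_distrib]
          simp only [this, Complex.ofReal_add, mul_add, Complex.exp_add]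
          ring
      _ = ∫ y, ∫ ξ, Complex.exp (2 * (Real.pi : ℂ) * Complex.I * (dotProd (x + y) ξ : ℂ)) *
          (g ξ * fourierT (φ x) y) := integral_integral_swap hintegral
      _ = ∫ y, fourierT (φ x) y * fourierT g (-(x + y)) := by
          refine integral_congr_ae (.of_forall fun y => ?_)
          simp only [fourierT]
          rw [← integral_const_mul]
          refine integral_congr_ae (.of_forall fun ξ => ?_)
          simp only [dotProd_comm ξ, dotProd_neg_left, Complex.ofReal_neg, mul_neg, neg_neg]
          ring
      _ = _ := by
          rw [← integral_sub_right_eq_self _ x]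
          simp
  have hu : Measurable fun w => ‖fourierT g (-w)‖ₑ := (hgc.comp continuous_neg).enorm.measurable
  calc ∫⁻ x, ‖symbolOp σ g x‖ₑ ^ 2
      ≤ ∫⁻ x, (∫⁻ w, ENNReal.ofReal (κ (x - w)) * ‖fourierT g (-w)‖ₑ) ^ 2 := by
        refine lintegral_mono fun x => ?_
        gcongr
        rw [hrep]
        refine (enorm_integral_le_lintegral_enorm _).trans (lintegral_mono fun w => ?_)
        rw [enorm_mul]
        gcongr
        rw [← ofReal_norm]
        refine ENNReal.ofReal_le_ofReal ((hφκ x _).trans_eq ?_)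
        rw [← hκe, neg_sub]
    _ ≤ (∫⁻ t, ENNReal.ofReal (κ t)) ^ 2 * ∫⁻ w, ‖fourierT g (-w)‖ₑ ^ 2 :=
        lintegral_sq_convolution_le (κ := fun t => ENNReal.ofReal (κ t)) hκm.ennreal_ofReal
          hu.aemeasurable
    _ = _ := by
        rw [lintegral_neg_eq_self (fun w => ‖fourierT g w‖ₑ ^ 2), lintegral_enorm_sq_eq,
          eLpNorm_fourierT_eq hg hg2, lintegral_enorm_sq_eq]

end SymbolOp

section Block

variable {N : ℕ}

lemma integral_norm_le_of_forall_notMem {E : Type*} [MeasurableSpace E] {μ : Measure E}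
    {g : E → ℂ} {S : Set E} (hS : μ S < ⊤) {M : ℝ} (hM : ∀ x ∈ S, ‖g x‖ ≤ M)
    (h0 : ∀ x ∉ S, g x = 0) : ∫ x, ‖g x‖ ∂μ ≤ M * μ.real S := by
  rw [← setIntegral_eq_integral_of_forall_compl_eq_zero (s := S) (fun x hx => by simp [h0 x hx])]
  refine (Real.le_norm_self _).trans (norm_setIntegral_le_of_norm_le_const hS fun x hx => ?_)
  rw [norm_norm]
  exact hM x hx

/-- The integrable weight `(1 + ‖t‖)^{-(N+1)}` on `ℝ^N`. -/
noncomputable def decayWeight (t : Fin N → ℝ) : ℝ := (1 + ‖t‖) ^ (-((N : ℝ) + 1))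

lemma decayWeight_nonneg (t : Fin N → ℝ) : 0 ≤ decayWeight t := by
  unfold decayWeight; positivity

lemma integrable_decayWeight : Integrable (decayWeight (N := N)) :=
  integrable_one_add_norm (by simp)

lemma measurable_decayWeight : Measurable (decayWeight (N := N)) := by
  unfold decayWeight; fun_prop

lemma decayWeight_eq (t : Fin N → ℝ) : decayWeight t = ((1 + ‖t‖) ^ (N + 1))⁻¹ := by
  rw [decayWeight, Real.rpow_neg (by positivity), ← Real.rpow_natCast]
  push_cast
  rfl

/-- A quantity `q ≤ M` with `‖t‖^{N+1} q ≤ M` is bounded by `decayWeight t`. -/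
lemma le_mul_decayWeight {q M : ℝ} (hq : 0 ≤ q) (t : Fin N → ℝ) (h0 : q ≤ M)
    (h1 : ‖t‖ ^ (N + 1) * q ≤ M) : q ≤ 2 ^ (N + 1) * M * decayWeight t := by
  rw [decayWeight_eq, ← div_eq_mul_inv, le_div_iff₀ (by positivity)]
  have h2 : (1 + ‖t‖) ^ (N + 1) ≤ 2 ^ N * (1 + ‖t‖ ^ (N + 1)) := by
    simpa using add_pow_le zero_le_one (norm_nonneg t) (N + 1)
  calc q * (1 + ‖t‖) ^ (N + 1) ≤ q * (2 ^ N * (1 + ‖t‖ ^ (N + 1))) := by gcongr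
    _ = 2 ^ N * (q + ‖t‖ ^ (N + 1) * q) := by ring
    _ ≤ 2 ^ N * (M + M) := by gcongr
    _ = 2 ^ (N + 1) * M := by ring

/-- A smooth cutoff with uniformly bounded partial derivatives up to order `k`. -/
lemma exists_smooth_cutoff (N k : ℕ) : ∃ (χ : (Fin N → ℝ) → ℂ) (X : ℝ),
    ContDiff ℝ (⊤ : ℕ∞) χ ∧ (∀ x, ‖x‖ ≤ 1 → χ x = 1) ∧
    tsupport χ ⊆ Metric.closedBall 0 2 ∧ 0 ≤ X ∧
    ∀ (j : Fin N), ∀ i ≤ k, ∀ x, ‖(coordDeriv j)^[i] χ x‖ ≤ X := by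
  let b : ContDiffBump (0 : Fin N → ℝ) := ⟨1, 2, one_pos, one_lt_two⟩
  let χ : (Fin N → ℝ) → ℂ := fun x => (b x : ℂ)
  have hχ : ContDiff ℝ (⊤ : ℕ∞) χ := Complex.ofRealCLM.contDiff.comp b.contDiff
  have hsub : tsupport χ ⊆ Metric.closedBall 0 2 := by
    refine closure_minimal (fun x hx => ?_) Metric.isClosed_closedBall
    have hx' : x ∈ Function.support b := by
      intro h
      exact hx (by simp [χ, h])
    rw [b.support_eq] at hx'
    exact Metric.ball_subset_closedBall hx'
  have hc : HasCompactSupport χ :=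
    (isCompact_closedBall (0 : Fin N → ℝ) 2).of_isClosed_subset (isClosed_tsupport _) hsub
  have hbd : ∀ (j : Fin N) (i : ℕ), ∃ X : ℝ, ∀ x, ‖(coordDeriv j)^[i] χ x‖ ≤ X := fun j i =>
    (hc.iterate_coordDeriv j i).exists_bound_of_continuous (hχ.iterate_coordDeriv j i).continuous
  choose X hX using hbd
  have hX0 : ∀ j i, 0 ≤ X j i := fun j i => (norm_nonneg _).trans (hX j i 0)
  refine ⟨χ, ∑ j, ∑ i ∈ Finset.range (k + 1), X j i, hχ, fun x hx => ?_, hsub, ?_, ?_⟩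
  · have : b x = 1 := b.one_of_mem_closedBall (by simpa using hx)
    simp [χ, this]
  · exact Finset.sum_nonneg fun j _ => Finset.sum_nonneg fun i _ => hX0 j i
  · intro j i hi x
    refine (hX j i x).trans ?_
    refine (Finset.single_le_sum (f := fun i => X j i) (fun i _ => hX0 j i)
      (Finset.mem_range.2 (by omega : i < k + 1))).trans ?_
    exact Finset.single_le_sum (f := fun j => ∑ i ∈ Finset.range (k + 1), X j i)
      (fun j _ => Finset.sum_nonneg fun i _ => hX0 j i) (Finset.mem_univ j)

/-- The dilated weight `h^N (1 + h‖t‖)^{-(N+1)}` has the same integral as `decayWeight`. -/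
lemma lintegral_dilated_decayWeight {h : ℝ} (hh : 0 < h) {A : ℝ} (hA : 0 ≤ A) :
    Integrable (fun t : Fin N → ℝ => A * h ^ N * decayWeight (h • t)) ∧
    ∫⁻ t : Fin N → ℝ, ENNReal.ofReal (A * h ^ N * decayWeight (h • t)) =
      ENNReal.ofReal (A * ∫ t : Fin N → ℝ, decayWeight t) := by
  have hi : Integrable (fun t : Fin N → ℝ => A * h ^ N * decayWeight (h • t)) :=
    (integrable_decayWeight.comp_smul hh.ne').const_mul _
  refine ⟨hi, ?_⟩
  rw [← ofReal_integral_eq_lintegral_ofReal hi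
    (.of_forall fun t => mul_nonneg (by positivity) (decayWeight_nonneg _)),
    integral_const_mul, Measure.integral_comp_smul]
  congr 1
  simp only [Module.finrank_fin_fun, smul_eq_mul, abs_inv, abs_pow, abs_of_pos hh]
  field_simp

/-- A symbol whose pure frequency derivatives of order `i` are bounded by `B h^{-i}` on a cube of
side `4h` is bounded, with constant comparable to `B`, on functions whose frequencies lie in the
concentric cube of side `2h`. -/
lemma lintegral_symbolOp_block_le [NeZero N] : ∃ C : ℝ, 0 ≤ C ∧
    ∀ (σ : (Fin N → ℝ) → (Fin N → ℝ) → ℂ) (B h : ℝ) (a : Fin N → ℝ) (g : (Fin N → ℝ) → ℂ),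
      0 ≤ B → 0 < h → (∀ x, ContDiff ℝ (⊤ : ℕ∞) (σ x)) →
      (∀ x j, ∀ i ≤ N + 1, ∀ ξ, ‖ξ - a‖ ≤ 2 * h →
        ‖(coordDeriv j)^[i] (σ x) ξ‖ ≤ B * h⁻¹ ^ i) →
      Integrable g → MemLp g 2 → (∀ ξ, g ξ ≠ 0 → ‖ξ - a‖ ≤ h) →
      ∫⁻ x, ‖symbolOp σ g x‖ₑ ^ 2 ≤ ENNReal.ofReal (C * B) ^ 2 * ∫⁻ ξ, ‖g ξ‖ₑ ^ 2 := by
  obtain ⟨χ, X, hχ, hχ1, hχs, hX0, hX⟩ := exists_smooth_cutoff N (N + 1)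
  have hI : 0 ≤ ∫ t : Fin N → ℝ, decayWeight t := integral_nonneg decayWeight_nonneg
  refine ⟨2 ^ (N + 1) * (X * 2 ^ (N + 1) * 4 ^ N) * ∫ t : Fin N → ℝ, decayWeight t,
    by positivity, fun σ B h a g hB hh hσ hder hg hg2 hsupp => ?_⟩
  set v : (Fin N → ℝ) → ℂ := fun ξ => χ (h⁻¹ • (ξ - a)) with hv
  have hvs : ContDiff ℝ (⊤ : ℕ∞) v :=
    hχ.comp ((contDiff_id.sub contDiff_const).const_smul h⁻¹)
  let φ : (Fin N → ℝ) → (Fin N → ℝ) → ℂ := fun x ξ => σ x ξ * v ξ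
  have hφ : ∀ x, ContDiff ℝ (⊤ : ℕ∞) (φ x) := fun x => (hσ x).mul hvs
  have hnorm : ∀ ξ, ‖h⁻¹ • (ξ - a)‖ = h⁻¹ * ‖ξ - a‖ := fun ξ => by
    rw [norm_smul, Real.norm_of_nonneg (by positivity)]
  have hφs : ∀ x, tsupport (φ x) ⊆ Metric.closedBall a (2 * h) := by
    refine fun x => closure_minimal (fun ξ hξ => ?_) Metric.isClosed_closedBall
    have h1 : h⁻¹ • (ξ - a) ∈ tsupport χ := subset_tsupport _ (right_ne_zero_of_mul hξ)
    have h2 := hχs h1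
    rw [mem_closedBall_zero_iff, hnorm, inv_mul_le_iff₀ hh] at h2
    rw [mem_closedBall_iff_norm]
    linarith
  have hφc : ∀ x, HasCompactSupport (φ x) := fun x =>
    (isCompact_closedBall a (2 * h)).of_isClosed_subset (isClosed_tsupport _) (hφs x)
  have hφi : ∀ x, Integrable (φ x) := fun x =>
    (hφ x).continuous.integrable_of_hasCompactSupport (hφc x)
  have hvb : ∀ j, ∀ i ≤ N + 1, ∀ ξ, ‖(coordDeriv j)^[i] v ξ‖ ≤ X * h⁻¹ ^ i := by
    intro j i hi ξ
    rw [hv, iterate_coordDeriv_comp_smul_sub hχ, norm_mul, norm_pow, Complex.norm_real,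
      Real.norm_of_nonneg (by positivity), mul_comm]
    gcongr
    exact hX j i hi _
  set M : ℝ := B * X * 2 ^ (N + 1) * (4 * h) ^ N with hM
  have hintegral : ∀ x j, ∀ i ≤ N + 1, ∫ ξ, ‖(coordDeriv j)^[i] (φ x) ξ‖ ≤ M * h⁻¹ ^ i := by
    intro x j i hi
    have h1 : ∀ ξ ∈ Metric.closedBall a (2 * h),
        ‖(coordDeriv j)^[i] (φ x) ξ‖ ≤ B * X * (2 * h⁻¹) ^ i := by
      intro ξ hξ
      rw [mem_closedBall_iff_norm] at hξ
      exact norm_iterate_coordDeriv_mul_le j ξ i (hσ x) hvs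
        (fun i' hi' => hder x j i' (hi'.trans hi) ξ hξ) (fun i' hi' => hvb j i' (hi'.trans hi) ξ)
    have h2 := integral_norm_le_of_forall_notMem (μ := volume)
      (isCompact_closedBall a (2 * h)).measure_lt_top h1 (fun ξ hξ =>
        image_eq_zero_of_notMem_tsupport fun hmem =>
          hξ (hφs x (tsupport_iterate_coordDeriv_subset (φ x) j i hmem)))
    refine h2.trans ?_
    have hvol : (volume : Measure (Fin N → ℝ)).real (Metric.closedBall a (2 * h)) = (4 * h) ^ N := by
      rw [Measure.real, Real.volume_pi_closedBall _ (by positivity), ENNReal.toReal_ofReal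
        (by positivity)]
      simp only [Fintype.card_fin]
      congr 1
      ring
    rw [hvol, mul_pow 2, hM]
    calc B * X * (2 ^ i * h⁻¹ ^ i) * (4 * h) ^ N = B * X * 2 ^ i * (4 * h) ^ N * h⁻¹ ^ i := by ring
      _ ≤ _ := by
        gcongr
        exact one_le_two
  have hdecay : ∀ x t, ‖fourierT (φ x) t‖ ≤
      2 ^ (N + 1) * (B * X * 2 ^ (N + 1) * 4 ^ N) * h ^ N * decayWeight (h • t) := by
    intro x t
    have h0 := norm_pow_mul_fourierT_le (hφ x) (hφc x) 0 (fun j => hintegral x j 0 (by omega)) t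
    have h1 := norm_pow_mul_fourierT_le (hφ x) (hφc x) (N + 1) (fun j => hintegral x j _ le_rfl) t
    refine (le_mul_decayWeight (M := M) (norm_nonneg _) (h • t) (by simpa using h0) ?_).trans_eq ?_
    · rw [norm_smul, Real.norm_of_nonneg hh.le, mul_pow, mul_assoc]
      calc _ ≤ h ^ (N + 1) * (M * h⁻¹ ^ (N + 1)) := by gcongr
        _ = M := by rw [inv_pow]; field_simp
    · rw [hM]; ring
  obtain ⟨hκi, hκ⟩ := lintegral_dilated_decayWeight (N := N) hh
    (A := 2 ^ (N + 1) * (B * X * 2 ^ (N + 1) * 4 ^ N)) (by positivity)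
  have key := lintegral_symbolOp_sq_le (fun x => (hφ x).continuous) hφi hκi
    (by have := measurable_decayWeight (N := N); fun_prop)
    (fun t => by simp [decayWeight]) hdecay hg hg2 (σ := σ) ?_
  · refine key.trans_eq ?_
    rw [hκ]
    congr 3
    ring
  · intro x ξ
    by_cases hξ : g ξ = 0
    · simp [hξ]
    · have : v ξ = 1 := hχ1 _ (by
        rw [hnorm, inv_mul_le_iff₀ hh, mul_one]; exact hsupp ξ hξ)
      simp [φ, this]

end Block

section Cells

variable {N : ℕ}

/-- The dyadic level of a frequency: the `j` with `2^j ≤ 1 + ‖ξ‖ < 2^{j+1}`. -/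
noncomputable def freqLevel (ξ : Fin N → ℝ) : ℕ := Nat.log 2 ⌊1 + ‖ξ‖⌋₊

/-- The side length of the frequency cells of dyadic level `j`. -/
noncomputable def freqMesh (ρ : ℝ) (j : ℕ) : ℝ := ((2 : ℝ) ^ j) ^ ρ / 8

/-- The frequency cell containing `ξ`, recorded by its dyadic level and lattice point. -/
noncomputable def freqCell (ρ : ℝ) (ξ : Fin N → ℝ) : ℕ × (Fin N → ℤ) :=
  (freqLevel ξ, fun i => ⌊ξ i / freqMesh ρ (freqLevel ξ)⌋)

/-- The finitely many cells that are regarded as close to `ζ`. -/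
noncomputable def nearCells (ρ : ℝ) (ζ : Fin N → ℝ) : Finset (ℕ × (Fin N → ℤ)) :=
  (Finset.Icc (freqLevel ζ - 1) (freqLevel ζ + 1)).biUnion fun j =>
    (Finset.Icc (fun i => ⌊ζ i / freqMesh ρ j⌋ - 1) (fun i => ⌊ζ i / freqMesh ρ j⌋ + 1)).image
      (Prod.mk j)

lemma two_pow_freqLevel_le (ξ : Fin N → ℝ) : (2 : ℝ) ^ freqLevel ξ ≤ 1 + ‖ξ‖ := by
  have h1 : 1 ≤ ⌊1 + ‖ξ‖⌋₊ := by
    rw [Nat.one_le_floor_iff]; linarith [norm_nonneg ξ]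
  have h2 := Nat.pow_log_le_self 2 (Nat.one_le_iff_ne_zero.1 h1)
  refine le_trans ?_ (Nat.floor_le (by positivity : 0 ≤ 1 + ‖ξ‖))
  exact_mod_cast h2

lemma lt_two_pow_freqLevel_succ (ξ : Fin N → ℝ) : 1 + ‖ξ‖ < (2 : ℝ) ^ (freqLevel ξ + 1) := by
  have h2 := Nat.lt_pow_succ_log_self (b := 2) (by norm_num) ⌊1 + ‖ξ‖⌋₊
  refine (Nat.lt_floor_add_one _).trans_le ?_
  exact_mod_cast h2

lemma freqMesh_pos (ρ : ℝ) (j : ℕ) : 0 < freqMesh ρ j := by unfold freqMesh; positivity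

lemma freqMesh_le {ρ : ℝ} (hρ1 : ρ ≤ 1) (j : ℕ) : freqMesh ρ j ≤ 2 ^ j / 8 := by
  unfold freqMesh
  gcongr
  exact Real.rpow_le_self_of_one_le (one_le_pow₀ one_le_two) hρ1

lemma measurable_freqCell (ρ : ℝ) : Measurable (freqCell (N := N) ρ) := by
  have h1 : Measurable (freqLevel (N := N)) := by
    unfold freqLevel
    exact (measurable_from_nat (f := Nat.log 2)).comp
      (Nat.measurable_floor.comp (by fun_prop))
  refine h1.prodMk (measurable_pi_lambda _ fun i => Int.measurable_floor.comp ?_)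
  exact (measurable_pi_apply i).div ((measurable_from_nat (f := freqMesh ρ)).comp h1)

lemma card_nearCells_le (ρ : ℝ) (ζ : Fin N → ℝ) : (nearCells ρ ζ).card ≤ 3 * 3 ^ N := by
  refine (Finset.card_biUnion_le_card_mul _ _ (3 ^ N) fun j _ => ?_).trans ?_
  · refine Finset.card_image_le.trans_eq ?_
    rw [Pi.card_Icc]
    simp only [Int.card_Icc]
    rw [Finset.prod_congr rfl (g := fun _ => 3) fun i _ => by omega]
    simp
  · gcongr
    rw [Nat.card_Icc]
    omega

/-- The points of a cell lie within the mesh size of its lattice point. -/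
lemma norm_sub_le_of_freqCell_eq {ρ : ℝ} {ξ : Fin N → ℝ} {j : ℕ} {m : Fin N → ℤ}
    (h : freqCell ρ ξ = (j, m)) : ‖ξ - fun i => freqMesh ρ j * m i‖ ≤ freqMesh ρ j := by
  have hpos := freqMesh_pos ρ j
  rw [pi_norm_le_iff_of_nonneg hpos.le]
  intro i
  simp only [freqCell, Prod.mk.injEq] at h
  obtain ⟨rfl, rfl⟩ := h
  have h1 := Int.floor_le (ξ i / freqMesh ρ (freqLevel ξ))
  have h2 := Int.lt_floor_add_one (ξ i / freqMesh ρ (freqLevel ξ))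
  rw [le_div_iff₀ hpos] at h1
  rw [div_lt_iff₀ hpos] at h2
  rw [Pi.sub_apply, Real.norm_eq_abs, abs_le]
  constructor <;> nlinarith

/-- A frequency whose cell is not close to `ζ` is at distance at least comparable to
`(1 + ‖ξ‖)^ρ` from `ζ`. -/
lemma rpow_le_of_freqCell_notMem {ρ : ℝ} (hρ0 : 0 ≤ ρ) (hρ1 : ρ ≤ 1) {ζ ξ : Fin N → ℝ}
    (h : freqCell ρ ξ ∉ nearCells ρ ζ) : (1 + ‖ξ‖) ^ ρ ≤ 16 * ‖ζ - ξ‖ := by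
  contrapose! h
  have h1 : (1 + ‖ξ‖) ^ ρ ≤ 1 + ‖ξ‖ :=
    Real.rpow_le_self_of_one_le (by linarith [norm_nonneg ξ]) hρ1
  have hξ1 := two_pow_freqLevel_le ξ
  have hξ2 := lt_two_pow_freqLevel_succ ξ
  have hζ1 := two_pow_freqLevel_le ζ
  have hζ2 := lt_two_pow_freqLevel_succ ζ
  have ht1 : ‖ζ‖ ≤ ‖ξ‖ + ‖ζ - ξ‖ := by simpa using norm_add_le ξ (ζ - ξ)
  have ht2 : ‖ξ‖ ≤ ‖ζ‖ + ‖ζ - ξ‖ := by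
    rw [norm_sub_rev]; simpa using norm_add_le ζ (ξ - ζ)
  have hn := norm_nonneg ξ
  have hl1 : freqLevel ζ < freqLevel ξ + 2 := by
    have : (2 : ℝ) ^ freqLevel ζ < 2 ^ (freqLevel ξ + 2) := by
      rw [pow_succ] at hξ2 ⊢; rw [pow_succ]; linarith
    exact (pow_lt_pow_iff_right₀ one_lt_two).1 this
  have hl2 : freqLevel ξ < freqLevel ζ + 2 := by
    have : (2 : ℝ) ^ freqLevel ξ < 2 ^ (freqLevel ζ + 2) := by
      rw [pow_succ] at hζ2 ⊢; rw [pow_succ]; linarith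
    exact (pow_lt_pow_iff_right₀ one_lt_two).1 this
  have hmesh : (1 + ‖ξ‖) ^ ρ ≤ 16 * freqMesh ρ (freqLevel ξ) := by
    calc (1 + ‖ξ‖) ^ ρ ≤ (2 ^ freqLevel ξ * 2) ^ ρ := by
          gcongr
          rw [← pow_succ]; exact hξ2.le
      _ = (2 ^ freqLevel ξ) ^ ρ * 2 ^ ρ := Real.mul_rpow (by positivity) (by positivity)
      _ ≤ (2 ^ freqLevel ξ) ^ ρ * 2 := by
          gcongr
          exact Real.rpow_le_self_of_one_le one_le_two hρ1
      _ = _ := by unfold freqMesh; ring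
  have hpos := freqMesh_pos ρ (freqLevel ξ)
  have hcoord : ∀ i, |ζ i / freqMesh ρ (freqLevel ξ) - ξ i / freqMesh ρ (freqLevel ξ)| < 1 := by
    intro i
    rw [← sub_div, abs_div, abs_of_pos hpos, div_lt_one hpos]
    have := norm_le_pi_norm (ζ - ξ) i
    rw [Pi.sub_apply, Real.norm_eq_abs] at this
    linarith
  rw [nearCells, Finset.mem_biUnion]
  refine ⟨freqLevel ξ, Finset.mem_Icc.2 ⟨by omega, by omega⟩, Finset.mem_image.2 ⟨_, ?_, rfl⟩⟩
  rw [Finset.mem_Icc, Pi.le_def, Pi.le_def]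
  refine ⟨fun i => ?_, fun i => ?_⟩
  · have := (abs_lt.1 (hcoord i)).2
    rw [Int.le_floor]
    have h3 := Int.floor_le (ζ i / freqMesh ρ (freqLevel ξ))
    push_cast
    linarith
  · have := (abs_lt.1 (hcoord i)).1
    rw [← Int.floor_add_one]
    exact Int.floor_le_floor (by linarith)

lemma jweight_neg_mul_le {ρ : ℝ} (hρ0 : 0 ≤ ρ) (hρ1 : ρ ≤ 1) {ξ₀ ξ : Fin N → ℝ} {j : ℕ}
    {m : Fin N → ℤ} (h : freqCell ρ ξ₀ = (j, m))
    (hξ : ‖ξ - fun i => freqMesh ρ j * m i‖ ≤ 2 * freqMesh ρ j) (i : ℕ) :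
    jweight (-(ρ * i)) ξ ≤ (freqMesh ρ j)⁻¹ ^ i := by
  have h0 := norm_sub_le_of_freqCell_eq h
  have hj : freqLevel ξ₀ = j := congrArg Prod.fst h
  have hm := freqMesh_le hρ1 j
  have h1 := two_pow_freqLevel_le ξ₀
  rw [hj] at h1
  have h2 : ‖ξ₀‖ ≤ ‖ξ‖ + 3 * freqMesh ρ j := by
    calc ‖ξ₀‖ = ‖ξ + ((ξ₀ - fun i => freqMesh ρ j * m i) - (ξ - fun i => freqMesh ρ j * m i))‖ := by
          congr 1; abel
      _ ≤ ‖ξ‖ + (‖ξ₀ - fun i => freqMesh ρ j * m i‖ + ‖ξ - fun i => freqMesh ρ j * m i‖) :=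
          (norm_add_le _ _).trans (by gcongr; exact norm_sub_le _ _)
      _ ≤ _ := by linarith
  have h3 : ((2 : ℝ) ^ j / 4) ^ 2 ≤ 1 + ‖ξ‖ ^ 2 := by
    have h4 : (2 : ℝ) ^ j / 4 ≤ (1 + ‖ξ‖) / 2 := by linarith [norm_nonneg ξ]
    calc ((2 : ℝ) ^ j / 4) ^ 2 ≤ ((1 + ‖ξ‖) / 2) ^ 2 := by gcongr
      _ ≤ _ := by nlinarith [sq_nonneg (1 - ‖ξ‖)]
  have h5 : freqMesh ρ j ≤ (1 + ‖ξ‖ ^ 2) ^ (ρ / 2) := by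
    calc freqMesh ρ j ≤ (2 ^ j) ^ ρ / 4 := by
          unfold freqMesh
          gcongr
          norm_num
      _ ≤ (2 ^ j) ^ ρ / 4 ^ ρ := by
          gcongr
          exact Real.rpow_le_self_of_one_le (by norm_num) hρ1
      _ = (((2 : ℝ) ^ j / 4) ^ 2) ^ (ρ / 2) := by
          rw [← Real.div_rpow (by positivity) (by positivity), ← Real.rpow_natCast_mul (by positivity)]
          congr 1
          push_cast
          ring
      _ ≤ _ := by gcongr
  have hpos := freqMesh_pos ρ j
  calc jweight (-(ρ * i)) ξ = ((1 + ‖ξ‖ ^ 2) ^ (ρ / 2))⁻¹ ^ i := by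
        rw [jweight, inv_pow, ← Real.rpow_mul_natCast (by positivity), ← Real.rpow_neg (by positivity)]
        congr 1
        ring
    _ ≤ _ := by gcongr

lemma jweight_le {s : ℝ} (hs : 0 ≤ s) (ξ : Fin N → ℝ) : jweight s ξ ≤ (1 + ‖ξ‖) ^ s := by
  have hn := norm_nonneg ξ
  calc jweight s ξ ≤ ((1 + ‖ξ‖) ^ 2) ^ (s / 2) := by
        unfold jweight
        gcongr
        nlinarith
    _ = _ := by
        rw [← Real.rpow_natCast_mul (by positivity)]
        congr 1
        push_cast
        ring

end Cells

section Splitting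

variable {N : ℕ}

/-- Off the cells close to `ζ`, the frequency kernel of a symbol of type `ρ, δ` decays. -/
lemma norm_symbolKernel_le [NeZero N] {ρ δ : ℝ} (hρ0 : 0 ≤ ρ) (hδ0 : 0 ≤ δ) {p : ℕ}
    (hp : δ * (N + 1 + p) ≤ ρ * p) {K₀ : Set (Fin N → ℝ)} (hK₀ : IsCompact K₀)
    {σ : (Fin N → ℝ) → (Fin N → ℝ) → ℂ} (hσ : ∀ ξ, ContDiff ℝ (⊤ : ℕ∞) fun x => σ x ξ)
    (hsupp : ∀ x ∉ K₀, ∀ ξ, σ x ξ = 0) {B : ℝ} (hB : 0 ≤ B)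
    (hder : ∀ j x ξ, ‖(coordDeriv j)^[N + 1 + p] (fun x' => σ x' ξ) x‖ ≤
      B * jweight (δ * ((N + 1 + p : ℕ) : ℝ)) ξ)
    {ζ ξ : Fin N → ℝ} (hfar : (1 + ‖ξ‖) ^ ρ ≤ 16 * ‖ζ - ξ‖) :
    ‖symbolKernel σ ζ ξ‖ ≤
      2 ^ (N + 1) * (16 ^ (N + 1 + p) * (B * volume.real K₀)) * decayWeight (ζ - ξ) := by
  set d := ‖ζ - ξ‖ with hd
  have hn := norm_nonneg ξ
  have hd1 : 1 ≤ 16 * d := (Real.one_le_rpow (by linarith) hρ0).trans hfar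
  have hd0 : 0 < d := by linarith
  have hts : tsupport (fun x => σ x ξ) ⊆ K₀ :=
    closure_minimal (fun x hx => by_contra fun h => hx (hsupp x h ξ)) hK₀.isClosed
  have hjw : jweight (δ * ((N + 1 + p : ℕ) : ℝ)) ξ ≤ (16 * d) ^ p := by
    calc jweight (δ * ((N + 1 + p : ℕ) : ℝ)) ξ
        ≤ (1 + ‖ξ‖) ^ (δ * ((N + 1 + p : ℕ) : ℝ)) := jweight_le (by positivity) ξ
      _ ≤ (1 + ‖ξ‖) ^ (ρ * p) := by
          refine Real.rpow_le_rpow_of_exponent_le (by linarith) ?_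
          push_cast
          exact hp
      _ = ((1 + ‖ξ‖) ^ ρ) ^ p := Real.rpow_mul_natCast (by positivity) _ _
      _ ≤ _ := by gcongr
  have hintegral : ∀ j, ∫ x, ‖(coordDeriv j)^[N + 1 + p] (fun x' => σ x' ξ) x‖ ≤
      B * (16 * d) ^ p * volume.real K₀ := fun j =>
    integral_norm_le_of_forall_notMem hK₀.measure_lt_top
      (fun x _ => (hder j x ξ).trans (by gcongr))
      (fun x hx => image_eq_zero_of_notMem_tsupport fun hmem =>
        hx (hts (tsupport_iterate_coordDeriv_subset _ j _ hmem)))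
  have hcs : HasCompactSupport fun x => σ x ξ :=
    hK₀.of_isClosed_subset (isClosed_tsupport _) hts
  have hdec := norm_pow_mul_fourierT_le (hσ ξ) hcs (N + 1 + p) hintegral (ζ - ξ)
  change d ^ (N + 1 + p) * ‖symbolKernel σ ζ ξ‖ ≤ _ at hdec
  set q := ‖symbolKernel σ ζ ξ‖ with hq
  have hq0 : 0 ≤ q := norm_nonneg _
  have hmain : (16 * d) ^ (N + 1) * q ≤ 16 ^ (N + 1 + p) * (B * volume.real K₀) := by
    refine le_of_mul_le_mul_left ?_ (pow_pos hd0 p)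
    calc d ^ p * ((16 * d) ^ (N + 1) * q) = 16 ^ (N + 1) * (d ^ (N + 1 + p) * q) := by ring
      _ ≤ 16 ^ (N + 1) * (B * (16 * d) ^ p * volume.real K₀) := by gcongr
      _ = _ := by ring
  refine le_mul_decayWeight hq0 (ζ - ξ) (le_trans ?_ hmain) (le_trans ?_ hmain)
  · exact le_mul_of_one_le_left hq0 (one_le_pow₀ hd1)
  · rw [← hd]
    gcongr
    linarith

/-- Split an integral along a measurable partition: the part over the finitely many cells in `S`
is estimated cell by cell. -/
lemma enorm_integral_sq_le_of_partition {E ι : Type*} [MeasurableSpace E] {μ : Measure E}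
    [MeasurableSpace ι] [MeasurableSingletonClass ι] {c : E → ι} (hc : Measurable c)
    (S : Finset ι) {M : ℕ} (hS : S.card ≤ M) {F g : E → ℂ} (hFg : Integrable (fun ξ => F ξ * g ξ) μ) :
    ‖∫ ξ, F ξ * g ξ ∂μ‖ₑ ^ 2 ≤
      2 * (∫⁻ ξ in {ξ | c ξ ∉ S}, ‖F ξ * g ξ‖ₑ ∂μ) ^ 2 +
        2 * M * ∑' l, ‖∫ ξ, F ξ * (c ⁻¹' {l}).indicator g ξ ∂μ‖ₑ ^ 2 := by
  have hm : ∀ l, MeasurableSet (c ⁻¹' {l}) := fun l => hc (measurableSet_singleton l)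
  set A : Set E := ⋃ l ∈ S, c ⁻¹' {l} with hA
  have hAm : MeasurableSet A := S.measurableSet_biUnion fun l _ => hm l
  have hAc : Aᶜ = {ξ | c ξ ∉ S} := by ext; simp [hA]
  set far : ℂ := ∫ ξ in Aᶜ, F ξ * g ξ ∂μ with hfar
  set b : ι → ℂ := fun l => ∫ ξ, F ξ * (c ⁻¹' {l}).indicator g ξ ∂μ with hb
  have hsum : ∫ ξ in A, F ξ * g ξ ∂μ = ∑ l ∈ S, b l := by
    rw [hA, integral_biUnion_finset S (fun l _ => hm l) _ (fun l _ => hFg.integrableOn)]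
    · refine Finset.sum_congr rfl fun l _ => ?_
      rw [hb, ← integral_indicator (hm l)]
      refine integral_congr_ae (.of_forall fun ξ => ?_)
      by_cases hξ : ξ ∈ c ⁻¹' {l} <;> simp [hξ]
    · intro l _ l' _ hne
      exact Disjoint.preimage c (Set.disjoint_singleton.2 hne)
  have htot : ∫ ξ, F ξ * g ξ ∂μ = ∑ l ∈ S, b l + far := by
    rw [← hsum, hfar, integral_add_compl hAm hFg]
  have hreal : ‖∑ l ∈ S, b l + far‖ ^ 2 ≤ 2 * ‖far‖ ^ 2 + 2 * M * ∑ l ∈ S, ‖b l‖ ^ 2 := by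
    have h1 : ‖∑ l ∈ S, b l‖ ^ 2 ≤ M * ∑ l ∈ S, ‖b l‖ ^ 2 := by
      calc ‖∑ l ∈ S, b l‖ ^ 2 ≤ (∑ l ∈ S, ‖b l‖) ^ 2 := by
            gcongr
            exact norm_sum_le _ _
        _ ≤ S.card * ∑ l ∈ S, ‖b l‖ ^ 2 := sq_sum_le_card_mul_sum_sq
        _ ≤ _ := by gcongr
    calc ‖∑ l ∈ S, b l + far‖ ^ 2 ≤ (‖∑ l ∈ S, b l‖ + ‖far‖) ^ 2 := by
          gcongr
          exact norm_add_le _ _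
      _ ≤ 2 * (‖∑ l ∈ S, b l‖ ^ 2 + ‖far‖ ^ 2) := add_sq_le
      _ ≤ _ := by linarith
  have henorm : ∀ z : ℂ, ‖z‖ₑ ^ 2 = ENNReal.ofReal (‖z‖ ^ 2) := fun z => by
    rw [ENNReal.ofReal_pow (norm_nonneg _), ofReal_norm]
  rw [htot]
  calc ‖∑ l ∈ S, b l + far‖ₑ ^ 2
      ≤ ENNReal.ofReal (2 * ‖far‖ ^ 2 + 2 * M * ∑ l ∈ S, ‖b l‖ ^ 2) := by
        rw [henorm]
        exact ENNReal.ofReal_le_ofReal hreal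
    _ = 2 * ‖far‖ₑ ^ 2 + 2 * M * ∑ l ∈ S, ‖b l‖ₑ ^ 2 := by
        rw [ENNReal.ofReal_add (by positivity) (by positivity), ENNReal.ofReal_mul (by norm_num),
          ENNReal.ofReal_mul (by positivity), ENNReal.ofReal_mul (by norm_num),
          ENNReal.ofReal_sum_of_nonneg (fun _ _ => by positivity)]
        simp only [henorm, ENNReal.ofReal_natCast, ENNReal.ofReal_ofNat]
    _ ≤ _ := by
        rw [← hAc]
        exact add_le_add
          (mul_le_mul_right (pow_le_pow_left' (enorm_integral_le_lintegral_enorm _) 2) _)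
          (mul_le_mul_right (ENNReal.sum_le_tsum S) _)

/-- The cells of a measurable countable partition carry the whole integral. -/
lemma tsum_lintegral_indicator_sq {E ι : Type*} [MeasurableSpace E] {μ : Measure E}
    [MeasurableSpace ι] [MeasurableSingletonClass ι] [Countable ι] {c : E → ι} (hc : Measurable c)
    (g : E → ℂ) :
    ∑' l, ∫⁻ ξ, ‖(c ⁻¹' {l}).indicator g ξ‖ₑ ^ 2 ∂μ = ∫⁻ ξ, ‖g ξ‖ₑ ^ 2 ∂μ := by
  have hm : ∀ l, MeasurableSet (c ⁻¹' {l}) := fun l => hc (measurableSet_singleton l)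
  have hU : ⋃ l, c ⁻¹' {l} = Set.univ := by ext; simp
  rw [← setLIntegral_univ (fun ξ => ‖g ξ‖ₑ ^ 2), ← hU, lintegral_iUnion hm]
  · refine tsum_congr fun l => ?_
    rw [← lintegral_indicator (hm l)]
    refine lintegral_congr fun ξ => ?_
    by_cases hξ : ξ ∈ c ⁻¹' {l} <;> simp [hξ]
  · intro l l' hne
    exact Disjoint.preimage c (Set.disjoint_singleton.2 hne)

end Splitting

section Main

variable {N : ℕ}

lemma two_mul_ofReal_sq_add_le {a b : ℝ} (ha : 0 ≤ a) (hb : 0 ≤ b) {M : ℕ} (hM : 1 ≤ M) :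
    2 * ENNReal.ofReal a ^ 2 + 2 * M * ENNReal.ofReal b ^ 2 ≤
      ENNReal.ofReal (2 * a + 2 * M * b) ^ 2 := by
  have h : 2 * a ^ 2 + 2 * M * b ^ 2 ≤ (2 * a + 2 * M * b) ^ 2 := by
    have hM' : (1 : ℝ) ≤ M := by exact_mod_cast hM
    have h1 : 0 ≤ M * (a * b) := by positivity
    have h2 : 0 ≤ M * b ^ 2 * (M - 1) := mul_nonneg (by positivity) (by linarith)
    have h3 : 0 ≤ M * b ^ 2 := by positivity
    nlinarith [sq_nonneg a]
  rw [← ENNReal.ofReal_pow (by positivity : 0 ≤ 2 * a + 2 * M * b)]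
  refine le_of_eq_of_le ?_ (ENNReal.ofReal_le_ofReal h)
  rw [ENNReal.ofReal_add (by positivity) (by positivity), ENNReal.ofReal_mul (by norm_num),
    ENNReal.ofReal_mul (by positivity), ENNReal.ofReal_mul (by norm_num), ENNReal.ofReal_pow ha,
    ENNReal.ofReal_pow hb, ENNReal.ofReal_natCast, ENNReal.ofReal_ofNat]

/-- The `L²` bound for order-zero symbols of type `ρ, δ` supported over `K₀`, acting on the
frequency side. -/
lemma exists_lintegral_symbolOp_sq_le [NeZero N] {ρ δ : ℝ} (hδ0 : 0 ≤ δ) (hδρ : δ < ρ)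
    (hρ1 : ρ ≤ 1) {K₀ : Set (Fin N → ℝ)} (hK₀ : IsCompact K₀) :
    ∃ (k : ℕ) (C : ℝ), 0 ≤ C ∧ ∀ (σ : (Fin N → ℝ) → (Fin N → ℝ) → ℂ) (B : ℝ),
      ContDiff ℝ (⊤ : ℕ∞) (Function.uncurry σ) → (∀ x ∉ K₀, ∀ ξ, σ x ξ = 0) → 0 ≤ B →
      (∀ Lx Lθ : List (Fin N), Lx.length ≤ k → Lθ.length ≤ k → ∀ x ξ,
        ‖symbolDeriv Lx Lθ σ x ξ‖ ≤
          B * jweight (-(ρ * (Lθ.length : ℝ)) + δ * (Lx.length : ℝ)) ξ) →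
      ∀ g : (Fin N → ℝ) → ℂ, Integrable g → MemLp g 2 →
        ∫⁻ x, ‖symbolOp σ g x‖ₑ ^ 2 ≤ ENNReal.ofReal (C * B) ^ 2 * ∫⁻ ξ, ‖g ξ‖ₑ ^ 2 := by
  have hρ0 : 0 ≤ ρ := hδ0.trans hδρ.le
  obtain ⟨p, hp⟩ := exists_nat_ge (δ * (N + 1) / (ρ - δ))
  rw [div_le_iff₀ (sub_pos.2 hδρ)] at hp
  obtain ⟨C₁, hC₁, hblock⟩ := lintegral_symbolOp_block_le (N := N)
  set I : ℝ := ∫ t : Fin N → ℝ, decayWeight t with hI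
  have hI0 : 0 ≤ I := integral_nonneg decayWeight_nonneg
  set C₂ : ℝ := 2 ^ (N + 1) * (16 ^ (N + 1 + p) * volume.real K₀) * I with hC₂
  have hC₂0 : 0 ≤ C₂ := by positivity
  refine ⟨N + 1 + p, 2 * C₂ + 2 * ((3 * 3 ^ N : ℕ) : ℝ) * C₁, by positivity,
    fun σ B hσ hsupp hB hder g hg hg2 => ?_⟩
  have hσc : Continuous (Function.uncurry σ) := hσ.continuous
  have hσx : ∀ x, ContDiff ℝ (⊤ : ℕ∞) (σ x) := fun x =>
    hσ.comp (contDiff_const.prodMk contDiff_id)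
  have hσξ : ∀ ξ, ContDiff ℝ (⊤ : ℕ∞) fun x => σ x ξ := fun ξ =>
    hσ.comp (contDiff_id.prodMk contDiff_const)
  have hbd : ∀ x ξ, ‖σ x ξ‖ ≤ B := fun x ξ => by
    simpa [symbolDeriv, jweight] using hder [] [] (by simp) (by simp) x ξ
  have hfar : ∀ {ζ ξ : Fin N → ℝ}, freqCell ρ ξ ∉ nearCells ρ ζ → ‖symbolKernel σ ζ ξ‖ ≤
      2 ^ (N + 1) * (16 ^ (N + 1 + p) * (B * volume.real K₀)) * decayWeight (ζ - ξ) := by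
    intro ζ ξ h
    refine norm_symbolKernel_le hρ0 hδ0 (by linarith) hK₀ hσξ hsupp hB (fun j x ξ => ?_)
      (rpow_le_of_freqCell_notMem hρ0 hρ1 h)
    have := hder (List.replicate (N + 1 + p) j) [] (by simp) (by simp) x ξ
    rw [symbolDeriv_replicate_nil] at this
    simpa using this
  set κ : (Fin N → ℝ) → ℝ := fun t =>
    2 ^ (N + 1) * (16 ^ (N + 1 + p) * (B * volume.real K₀)) * decayWeight t with hκ
  have hκm : Measurable κ := measurable_decayWeight.const_mul _
  have hκI : ∫⁻ t, ENNReal.ofReal (κ t) = ENNReal.ofReal (C₂ * B) := by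
    rw [← ofReal_integral_eq_lintegral_ofReal (integrable_decayWeight.const_mul _)
      (.of_forall fun t => mul_nonneg (by positivity) (decayWeight_nonneg _)), integral_const_mul]
    congr 1
    rw [hC₂]
    ring
  have hcm := measurable_freqCell (N := N) ρ
  have hcell : ∀ l, MeasurableSet (freqCell (N := N) ρ ⁻¹' {l}) := fun l =>
    hcm (measurableSet_singleton l)
  have hgl : ∀ l, Integrable ((freqCell ρ ⁻¹' {l}).indicator g) := fun l =>
    hg.indicator (hcell l)
  have hnear : ∀ l, ∫⁻ ζ, ‖∫ ξ, symbolKernel σ ζ ξ * (freqCell ρ ⁻¹' {l}).indicator g ξ‖ₑ ^ 2 ≤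
      ENNReal.ofReal (C₁ * B) ^ 2 * ∫⁻ ξ, ‖(freqCell ρ ⁻¹' {l}).indicator g ξ‖ₑ ^ 2 := by
    rintro ⟨j, m⟩
    rcases Set.eq_empty_or_nonempty (freqCell (N := N) ρ ⁻¹' {(j, m)}) with he | ⟨ξ₀, hξ₀⟩
    · simp [he]
    rw [lintegral_symbolOp_sq_eq hσc hK₀ hsupp hbd (hgl _)]
    refine hblock σ B (freqMesh ρ j) (fun i => freqMesh ρ j * m i) _ hB (freqMesh_pos ρ j) hσx
      (fun x l i hi ξ hξ => ?_) (hgl _) (hg2.indicator (hcell _)) (fun ξ hξ => ?_)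
    · have h1 := hder [] (List.replicate i l) (by simp) (by simp; omega) x ξ
      rw [symbolDeriv_nil_replicate] at h1
      refine h1.trans ?_
      gcongr
      simpa using jweight_neg_mul_le hρ0 hρ1 hξ₀ hξ i
    · have hmem : ξ ∈ freqCell ρ ⁻¹' {(j, m)} := Set.mem_of_indicator_ne_zero hξ
      exact norm_sub_le_of_freqCell_eq hmem
  have hmeas : ∀ l, Measurable fun ζ =>
      ‖∫ ξ, symbolKernel σ ζ ξ * (freqCell ρ ⁻¹' {l}).indicator g ξ‖ₑ ^ 2 := fun l =>
    measurable_enorm_integral_symbolKernel hσc hK₀ hsupp hbd (hgl l)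
  calc ∫⁻ x, ‖symbolOp σ g x‖ₑ ^ 2
      = ∫⁻ ζ, ‖∫ ξ, symbolKernel σ ζ ξ * g ξ‖ₑ ^ 2 :=
        (lintegral_symbolOp_sq_eq hσc hK₀ hsupp hbd hg).symm
    _ ≤ ∫⁻ ζ, (2 * (∫⁻ ξ, ENNReal.ofReal (κ (ζ - ξ)) * ‖g ξ‖ₑ) ^ 2 +
          2 * ((3 * 3 ^ N : ℕ) : ENNReal) *
            ∑' l, ‖∫ ξ, symbolKernel σ ζ ξ * (freqCell ρ ⁻¹' {l}).indicator g ξ‖ₑ ^ 2) := by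
        refine lintegral_mono fun ζ => (enorm_integral_sq_le_of_partition hcm (nearCells ρ ζ)
          (card_nearCells_le ρ ζ)
          (integrable_symbolKernel_mul hσc hK₀ hsupp hbd hg ζ)).trans ?_
        refine add_le_add_left (mul_le_mul_right (pow_le_pow_left' ?_ 2) _) _
        refine le_trans (setLIntegral_mono' ?_ fun ξ hξ => ?_) (setLIntegral_le_lintegral _ _)
        · exact (hcm (nearCells ρ ζ).measurableSet).compl
        · rw [enorm_mul, ← ofReal_norm (symbolKernel σ ζ ξ)]
          gcongr
          exact hfar hξ
    _ = 2 * (∫⁻ ζ, (∫⁻ ξ, ENNReal.ofReal (κ (ζ - ξ)) * ‖g ξ‖ₑ) ^ 2) +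
          2 * ((3 * 3 ^ N : ℕ) : ENNReal) * ∑' l, ∫⁻ ζ,
            ‖∫ ξ, symbolKernel σ ζ ξ * (freqCell ρ ⁻¹' {l}).indicator g ξ‖ₑ ^ 2 := by
        rw [lintegral_add_right _ ((Measurable.tsum hmeas).const_mul _),
          lintegral_const_mul' _ _ (by simp), lintegral_const_mul _ (Measurable.tsum hmeas),
          lintegral_tsum fun l => (hmeas l).aemeasurable]
    _ ≤ 2 * (ENNReal.ofReal (C₂ * B) ^ 2 * ∫⁻ ξ, ‖g ξ‖ₑ ^ 2) +
          2 * ((3 * 3 ^ N : ℕ) : ENNReal) *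
            (ENNReal.ofReal (C₁ * B) ^ 2 * ∫⁻ ξ, ‖g ξ‖ₑ ^ 2) := by
        refine add_le_add (mul_le_mul_right ?_ _) (mul_le_mul_right ?_ _)
        · rw [← hκI]
          exact lintegral_sq_convolution_le (κ := fun t => ENNReal.ofReal (κ t))
            hκm.ennreal_ofReal hg.aestronglyMeasurable.enorm
        · rw [← tsum_lintegral_indicator_sq hcm g, ← ENNReal.tsum_mul_left]
          exact ENNReal.tsum_le_tsum hnear
    _ ≤ _ := by
        rw [← mul_assoc, ← mul_assoc, ← add_mul]
        refine mul_le_mul_left ((two_mul_ofReal_sq_add_le (mul_nonneg hC₂0 hB)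
          (mul_nonneg hC₁ hB) (Nat.one_le_iff_ne_zero.2 (by positivity))).trans_eq ?_) _
        congr 2
        ring

end Main

end PdoHelpers

/-- continuity assertion of Proposition 5.2: for a fixed compact set `K₀`
there are `k ∈ ℕ` and `C > 0` such that for every order-zero symbol `σ` supported over `K₀`
and every bound `B ≥ 0` on the seminorms
`sup_{x,ξ} |∂^α_ξ ∂^β_x σ(x,ξ)| ⟨ξ⟩^{ρ|α| - δ|β|}` with `|α|, |β| ≤ k`, one has
`‖A_σ f‖_{L²} ≤ C B ‖f‖_{L²}` for all Schwartz `f`. In particular `σ ↦ A_σ` is continuous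
from symbols supported over `K₀` into bounded operators on `L²`. -/
theorem pdo_L2_bound_continuous_in_symbol {N : ℕ} (hN : 1 ≤ N)
    (ρ δ : ℝ) (hδ0 : 0 ≤ δ) (hδρ : δ < ρ) (hρ1 : ρ ≤ 1)
    (K₀ : Set (Fin N → ℝ)) (hK₀ : IsCompact K₀) :
    ∃ (k : ℕ) (C : ℝ), 0 < C ∧
      ∀ σ : (Fin N → ℝ) → (Fin N → ℝ) → ℂ,
        IsHormanderSymbol ρ δ 0 Set.univ σ →
        (∀ x : Fin N → ℝ, x ∉ K₀ → ∀ ξ : Fin N → ℝ, σ x ξ = 0) →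
        ∀ B : ℝ, 0 ≤ B →
        (∀ (Lx Lθ : List (Fin N)), Lx.length ≤ k → Lθ.length ≤ k →
          ∀ (x ξ : Fin N → ℝ),
            ‖symbolDeriv Lx Lθ σ x ξ‖ ≤
              B * jweight (-(ρ * (Lθ.length : ℝ)) + δ * (Lx.length : ℝ)) ξ) →
        ∀ f : SchwartzMap (Fin N → ℝ) ℂ,
          eLpNorm (pdoApply σ ⇑f) 2 volume ≤
            ENNReal.ofReal (C * B) * eLpNorm ⇑f 2 volume := by
  have : NeZero N := ⟨by omega⟩
  obtain ⟨k, C, hC, h⟩ := exists_lintegral_symbolOp_sq_le hδ0 hδρ hρ1 hK₀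
  refine ⟨k, C + 1, by positivity, fun σ hσ hsupp B hB hder f => ?_⟩
  have hσ' : ContDiff ℝ (⊤ : ℕ∞) (Function.uncurry σ) := by
    have := hσ.1
    rwa [Set.univ_prod_univ, contDiffOn_univ] at this
  have key := h σ B hσ' hsupp hB hder (fourierT f) (integrable_fourierT_schwartz f)
    (memLp_fourierT_schwartz f)
  rw [lintegral_enorm_sq_eq, lintegral_enorm_sq_eq,
    eLpNorm_fourierT_eq f.integrable (f.memLp 2 volume), ← mul_pow] at key
  calc eLpNorm (pdoApply σ ⇑f) 2 volume = eLpNorm (symbolOp σ (fourierT f)) 2 volume := rfl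
    _ ≤ ENNReal.ofReal (C * B) * eLpNorm ⇑f 2 volume :=
        (ENNReal.pow_le_pow_left_iff two_ne_zero).1 key
    _ ≤ _ := by
        gcongr
        linarith
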